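/- arXiv:1809.02363 — 2 statements merged into one kernel-verified Lean document; each statement's English description precedes it below -/
import Mathlib

section
/- For every prime p ≥ 5, deg ss_p^{(3*)}(X) = L^{(3*)}(p) if and only if p divides #Fi′₂₄, the order of the largest Fischer group (equivalently, if and only if p ∈ {5, 7, 11, 13, 17, 23, 29}). -/
open Polynomial

noncomputable section

/-- The class number h(√-d) of the imaginary quadratic field ℚ(√-d),
realized as the subfield of ℂ generated by i·√d. -/
def classNumberSqrtNeg (d : ℕ) : ℕ :=
  haveI : FiniteDimensional ℚ (IntermediateField.adjoin ℚ {(Complex.I * Real.sqrt d : ℂ)}) :=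
    IntermediateField.adjoin.finiteDimensional
      ⟨X ^ 2 + C (d : ℚ), monic_X_pow_add_C _ (by norm_num), by
        have h : (Complex.I * (Real.sqrt d : ℂ)) ^ 2 = -(d : ℂ) := by
          rw [mul_pow, Complex.I_sq, ← Complex.ofReal_pow, Real.sq_sqrt (Nat.cast_nonneg d)]
          simp
        simp [h]⟩
  haveI : NumberField (IntermediateField.adjoin ℚ {(Complex.I * Real.sqrt d : ℂ)}) := ⟨⟩
  NumberField.classNumber (IntermediateField.adjoin ℚ {(Complex.I * Real.sqrt d : ℂ)})

variable (p : ℕ) [Fact p.Prime]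

/-- ε = (1 - (-1|p))/2 -/
def eps : ℕ := ((1 - legendreSym p (-1)) / 2).toNat
/-- δ = (1 - (-3|p))/2 -/
def del : ℕ := ((1 - legendreSym p (-3)) / 2).toNat
/-- ν = (1 - (-2|p))/2 -/
def nu : ℕ := ((1 - legendreSym p (-2)) / 2).toNat

/-- The Pochhammer symbol (x)_n = x(x+1)⋯(x+n-1) in 𝔽_p. -/
def poch (x : ZMod p) (n : ℕ) : ZMod p := (ascPochhammer (ZMod p) n).eval x

/-- The level-3 Fricke supersingular polynomial ss_p^{(3*)}(X) ∈ 𝔽_p[X]: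
(X-108)^δ · Σ_{n=0}^{m₃} ((-m₃)_n (β₃)_n / (n!)²) 108^n X^{m₃+δ-n},
with m₃ = ⌊p/6⌋ and β₃ = 1/3 + δ/3. -/
def ss3Star : (ZMod p)[X] :=
  (X - C 108) ^ del p *
    ∑ n ∈ Finset.range (p / 6 + 1),
      C (poch p (-(p / 6 : ℕ) : ZMod p) n *
         poch p ((1 : ZMod p) / 3 + (del p : ZMod p) / 3) n /
         ((n.factorial : ZMod p)) ^ 2 * 108 ^ n) *
      X ^ (p / 6 + del p - n)

/-- L^{(3*)}(p): the number of distinct roots of ss_p^{(3*)}(X) in 𝔽_p. -/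
def L3Star : ℕ := (ss3Star p).roots.toFinset.card

/-- The order of the Monster simple group 𝕄. -/
def monsterOrder : ℕ :=
  2 ^ 46 * 3 ^ 20 * 5 ^ 9 * 7 ^ 6 * 11 ^ 2 * 13 ^ 3 * 17 * 19 * 23 * 29 * 31 * 41 * 47 * 59 * 71

/-- The order of the Baby monster group 𝔹. -/
def babyMonsterOrder : ℕ :=
  2 ^ 41 * 3 ^ 13 * 5 ^ 6 * 7 ^ 2 * 11 * 13 * 17 * 19 * 23 * 31 * 47

/-- The order of Fischer's sporadic group Fi′₂₄. -/
def fischer24Order : ℕ :=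
  2 ^ 21 * 3 ^ 16 * 5 ^ 2 * 7 ^ 3 * 11 * 13 * 17 * 23 * 29

section Computation

/-- The numerator of the ratio of consecutive coefficients of the level 3 polynomial, where
`d ∈ {0, 1}` plays the role of `δ`. -/
def coeffRatioNum (d n : ℕ) : ℕ := 6 * (6 * n + 1 + 4 * d) * (3 * n + 1 + d)

/-- The pair `(n!² cₙ, n!² ∑_{j ≤ n} cⱼ x^(n-j))` modulo `q`, for the coefficients `cⱼ` of the
level 3 polynomial. -/
def hornerPair (q d x : ℕ) : ℕ → ℕ × ℕ
  | 0 => (1, 1)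
  | n + 1 =>
    ((hornerPair q d x n).1 * coeffRatioNum d n % q,
     ((n + 1) ^ 2 * x * (hornerPair q d x n).2 + (hornerPair q d x n).1 * coeffRatioNum d n) % q)

/-- Decides whether `x` is a root of the level 3 polynomial modulo `q`. -/
def rootTest (q d x : ℕ) : Bool :=
  (x * (x + 108 * (q - 1))) ^ d * (hornerPair q d x (q / 6)).2 % q == 0

/-- The number of residues modulo `q` that pass `rootTest`. -/
def rootCount (q d : ℕ) : ℕ := (List.range q).countP (rootTest q d)

lemma degree_eq_rootCount_iff_of_lt : ∀ q ∈ List.range 167, 5 ≤ q → q.Prime →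
    (q / 6 + 2 * (q % 3 - 1) = rootCount q (q % 3 - 1) ↔ q ∣ fischer24Order) := by
  decide +kernel

end Computation

section DifferentialOperator

/-- The second order linear differential operator on polynomials with coefficients A, B and E. -/
def secondOrderOp {F : Type*} [Field F] (A B E : F[X]) : F[X] →ₗ[F] F[X] :=
  LinearMap.mulLeft F A ∘ₗ derivative ∘ₗ derivative + LinearMap.mulLeft F B ∘ₗ derivative +
    LinearMap.mulLeft F E

lemma secondOrderOp_apply {F : Type*} [Field F] (A B E y : F[X]) :
    secondOrderOp A B E y =
      A * derivative (derivative y) + B * derivative y + E * y := by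
  simp [secondOrderOp]

lemma coeff_X_mul_derivative {F : Type*} [Field F] (y : F[X]) (n : ℕ) :
    (X * derivative y).coeff n = n * y.coeff n := by
  cases n with
  | zero => simp
  | succ n => rw [coeff_X_mul, coeff_derivative, mul_comm]; push_cast; rfl

lemma coeff_X_sq_mul_derivative_derivative {F : Type*} [Field F] (y : F[X]) (n : ℕ) :
    (X ^ 2 * derivative (derivative y)).coeff n = n * (n - 1) * y.coeff n := by
  have h : X ^ 2 * derivative (derivative y) =
      X * derivative (X * derivative y) - X * derivative y := by
    simp only [derivative_mul, derivative_X]; ring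
  rw [h, coeff_sub, coeff_X_mul_derivative, coeff_X_mul_derivative]
  ring

/-- A polynomial of degree `< p` in the kernel of a Fuchsian operator with exponents `0, 0` at the
origin is determined by its constant coefficient. -/
lemma eq_zero_of_secondOrderOp_eq_zero {F : Type*} [Field F] {p : ℕ} [Fact p.Prime] [CharP F p]
    (h2 : (2 : F) ≠ 0)
    (b₂ b₁ e₁ e₀ : F) {y : F[X]} (hdeg : y.natDegree < p) (h0 : y.coeff 0 = 0)
    (hy : secondOrderOp (4 * X ^ 3 + 80 * X ^ 2 + 256 * X) (C b₂ * X ^ 2 + C b₁ * X + 256)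
      (C e₁ * X + C e₀) y = 0) : y = 0 := by
  have hcoeff : ∀ n < p, y.coeff n = 0 := by
    intro n
    induction n using Nat.strong_induction_on with
    | _ n ih =>
    intro hn
    rcases Nat.eq_zero_or_pos n with rfl | hpos
    · exact h0
    have key : X ^ 2 * (C 4 * (X ^ 2 * derivative (derivative y)) + C b₂ * (X * derivative y)
        + C e₁ * y) + X * (C 80 * (X ^ 2 * derivative (derivative y)) + C b₁ * (X * derivative y)
        + C e₀ * y) + (C 256 * (X ^ 2 * derivative (derivative y))
        + C 256 * (X * derivative y)) = 0 := by
      rw [secondOrderOp_apply] at hy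
      simp only [map_ofNat]
      linear_combination X * hy
    have hc := congrArg (fun q : F[X] => q.coeff n) key
    have hX : ∀ q : F[X], (X * q).coeff n = q.coeff (n - 1) := by
      intro q
      obtain ⟨k, rfl⟩ : ∃ k, n = k + 1 := ⟨n - 1, by omega⟩
      simp
    have hX2 : ∀ q : F[X], (X ^ 2 * q).coeff n = if 2 ≤ n then q.coeff (n - 2) else 0 :=
      fun q => coeff_X_pow_mul' q 2 n
    rw [coeff_add, coeff_add, hX, hX2] at hc
    simp only [coeff_add, coeff_zero, coeff_C_mul, coeff_X_mul_derivative,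
      coeff_X_sq_mul_derivative_derivative] at hc
    rw [ih (n - 1) (by omega) (by omega), ih (n - 2) (by omega) (by omega)] at hc
    have hn0 : (n : F) ≠ 0 := by
      rw [Ne, CharP.cast_eq_zero_iff F p]
      exact fun h => absurd (Nat.le_of_dvd hpos h) (by omega)
    have h256 : (256 : F) ≠ 0 := by
      have : (256 : F) = 2 ^ 8 := by norm_num
      rw [this]; exact pow_ne_zero _ h2
    have : 256 * (n : F) ^ 2 * y.coeff n = 0 := by
      have hc' : (0 : F) + (256 * (n * (n - 1) * y.coeff n) + 256 * (n * y.coeff n)) = 0 := by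
        simpa using hc
      linear_combination hc'
    exact (mul_eq_zero.mp this).resolve_left (mul_ne_zero h256 (pow_ne_zero 2 hn0))
  ext n
  rcases lt_or_ge n p with hn | hn
  · exact hcoeff n hn
  · rw [coeff_eq_zero_of_natDegree_lt (by omega)]; simp

lemma X_mul_derivative_monomial_mul_pow {F : Type*} [Field F] (k : F) (a e : ℕ) :
    X * (X + C k) * derivative (X ^ a * (X + C k) ^ e) =
      ((a : F[X]) * (X + C k) + (e : F[X]) * X) * (X ^ a * (X + C k) ^ e) := by
  have h1 : X * derivative (X ^ a : F[X]) = (a : F[X]) * X ^ a := by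
    cases a with
    | zero => simp
    | succ a => rw [derivative_X_pow]; push_cast [map_natCast]; simp; ring
  have h2 : (X + C k) * derivative ((X + C k) ^ e) = (e : F[X]) * (X + C k) ^ e := by
    cases e with
    | zero => simp
    | succ e => rw [derivative_X_add_C_pow]; push_cast [map_natCast]; simp; ring
  rw [derivative_mul]
  linear_combination (X + C k) * (X + C k) ^ e * h1 + X * X ^ a * h2

lemma sq_mul_derivative_derivative_monomial_mul_pow {F : Type*} [Field F] (k : F) (a e : ℕ) :
    (X * (X + C k)) ^ 2 * derivative (derivative (X ^ a * (X + C k) ^ e)) =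
      (X * (X + C k) * ((a : F[X]) + (e : F[X])) + ((a : F[X]) * (X + C k) + (e : F[X]) * X) ^ 2
        - (X + (X + C k)) * ((a : F[X]) * (X + C k) + (e : F[X]) * X)) * (X ^ a * (X + C k) ^ e) := by
  have h1 := X_mul_derivative_monomial_mul_pow k a e
  have h2 := congrArg derivative h1
  generalize X ^ a * (X + C k) ^ e = t at h1 h2 ⊢
  simp only [derivative_mul, derivative_add, derivative_X, derivative_C,
    derivative_natCast] at h2
  linear_combination X * (X + C k) * h2 +
    ((a : F[X]) * (X + C k) + e * X - (X + (X + C k))) * h1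

end DifferentialOperator

section Terms

lemma secondOrderOp_monomial_mul_add_four {F : Type*} [Field F] (n e : ℕ)
    (he : (2 * e + 1 + 6 * n : F[X]) = 0) :
    X * (X + 4) * secondOrderOp (4 * X ^ 3 + 80 * X ^ 2 + 256 * X) (8 * X ^ 2 + 120 * X + 256)
      (X + 8) (X ^ n * (X + 4) ^ e : F[X]) =
      16 * ((n : F[X]) ^ 2 * (X + 4) ^ 3 - 6 * (6 * (n : F[X]) + 1) * (3 * (n : F[X]) + 1) * X) *
        (X ^ n * (X + 4) ^ e) := by
  have h1 := X_mul_derivative_monomial_mul_pow (4 : F) n e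
  have h2 := sq_mul_derivative_derivative_monomial_mul_pow (4 : F) n e
  simp only [map_ofNat] at h1 h2
  rw [secondOrderOp_apply]
  generalize (X ^ n * (X + 4) ^ e : F[X]) = t at h1 h2 ⊢
  linear_combination 4 * (X + 16) * h2 + (8 * X ^ 2 + 120 * X + 256) * h1 +
    (2 * (X + 16) * X ^ 2 * e - (X + 16) * X ^ 2 * (1 + 6 * n) +
      2 * (X + 16) * X * (2 * n * (X + 4) - X) + (4 * X ^ 2 + 60 * X + 128) * X) * t * he

lemma secondOrderOp_monomial_mul_add_sixteen {F : Type*} [Field F] (n e : ℕ)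
    (he : (2 * e + 1 + 6 * n : F[X]) = 0) :
    X * (X + 16) * secondOrderOp (4 * X ^ 3 + 80 * X ^ 2 + 256 * X) (8 * X ^ 2 + 120 * X + 256)
      (X + 8) (X ^ (2 * n) * (X + 16) ^ e : F[X]) =
      4 * ((n : F[X]) ^ 2 * (X + 16) ^ 3 - 6 * (6 * (n : F[X]) + 1) * (3 * (n : F[X]) + 1) * X ^ 2) *
        (X ^ (2 * n) * (X + 16) ^ e) := by
  have h1 := X_mul_derivative_monomial_mul_pow (16 : F) (2 * n) e
  have h2 := sq_mul_derivative_derivative_monomial_mul_pow (16 : F) (2 * n) e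
  simp only [map_ofNat, Nat.cast_mul, Nat.cast_ofNat] at h1 h2
  rw [secondOrderOp_apply]
  generalize (X ^ (2 * n) * (X + 16) ^ e : F[X]) = t at h1 h2 ⊢
  linear_combination 4 * (X + 4) * h2 + (8 * X ^ 2 + 120 * X + 256) * h1 +
    (2 * (X + 4) * X ^ 2 * e - (X + 4) * X ^ 2 * (1 + 6 * n) +
      2 * (X + 4) * X * (4 * n * (X + 16) - X) + (4 * X ^ 2 + 60 * X + 128) * X) * t * he

lemma secondOrderOp_sub_two_mul_monomial {F : Type*} [Field F] (n e : ℕ)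
    (he : (2 * e + 5 + 6 * n : F[X]) = 0) :
    X * (X + 4) * secondOrderOp (4 * X ^ 3 + 80 * X ^ 2 + 256 * X) (16 * X ^ 2 + 200 * X + 256)
      (9 * X + 48) ((X - 2) * (X ^ n * (X + 4) ^ e) : F[X]) =
      16 * (X - 2) * ((n : F[X]) ^ 2 * (X + 4) ^ 3 - 6 * (6 * (n : F[X]) + 5) *
        (3 * (n : F[X]) + 2) * X) *
        (X ^ n * (X + 4) ^ e) := by
  have h1 := X_mul_derivative_monomial_mul_pow (4 : F) n e
  have h2 := sq_mul_derivative_derivative_monomial_mul_pow (4 : F) n e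
  simp only [map_ofNat] at h1 h2
  rw [secondOrderOp_apply]
  generalize (X ^ n * (X + 4) ^ e : F[X]) = t at h1 h2 ⊢
  simp only [derivative_mul, derivative_sub, derivative_add, derivative_X,
    derivative_ofNat, sub_zero, one_mul]
  linear_combination (X - 2) * 4 * (X + 16) * h2 + (2 * (4 * X ^ 3 + 80 * X ^ 2 + 256 * X) +
      (16 * X ^ 2 + 200 * X + 256) * (X - 2)) * h1 +
    ((X - 2) * (2 * (X + 16) * X ^ 2 * e - (X + 16) * X ^ 2 * (5 + 6 * n) +
      2 * (X + 16) * X * (2 * n * (X + 4) - X)) + (4 * X ^ 3 + 80 * X ^ 2 + 256 * X +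
        (8 * X ^ 2 + 100 * X + 128) * (X - 2)) * X) * t * he

lemma secondOrderOp_sub_thirtyTwo_mul_monomial {F : Type*} [Field F] (n e : ℕ)
    (he : (2 * e + 5 + 6 * n : F[X]) = 0) :
    X * (X + 16) * secondOrderOp (4 * X ^ 3 + 80 * X ^ 2 + 256 * X)
      (16 * X ^ 2 + 200 * X + 256) (9 * X + 48)
      ((X - 32) * (X ^ (2 * n) * (X + 16) ^ e) : F[X]) =
      4 * (X - 32) * ((n : F[X]) ^ 2 * (X + 16) ^ 3 - 6 * (6 * (n : F[X]) + 5) *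
        (3 * (n : F[X]) + 2) * X ^ 2) *
        (X ^ (2 * n) * (X + 16) ^ e) := by
  have h1 := X_mul_derivative_monomial_mul_pow (16 : F) (2 * n) e
  have h2 := sq_mul_derivative_derivative_monomial_mul_pow (16 : F) (2 * n) e
  simp only [map_ofNat, Nat.cast_mul, Nat.cast_ofNat] at h1 h2
  rw [secondOrderOp_apply]
  generalize (X ^ (2 * n) * (X + 16) ^ e : F[X]) = t at h1 h2 ⊢
  simp only [derivative_mul, derivative_sub, derivative_add, derivative_X,
    derivative_ofNat, sub_zero, one_mul]
  linear_combination (X - 32) * 4 * (X + 4) * h2 + (2 * (4 * X ^ 3 + 80 * X ^ 2 + 256 * X) +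
      (16 * X ^ 2 + 200 * X + 256) * (X - 32)) * h1 +
    ((X - 32) * (2 * (X + 4) * X ^ 2 * e - (X + 4) * X ^ 2 * (5 + 6 * n) +
      2 * (X + 4) * X * (4 * n * (X + 16) - X)) + (4 * X ^ 3 + 80 * X ^ 2 + 256 * X +
        (8 * X ^ 2 + 100 * X + 128) * (X - 32)) * X) * t * he

/-- Telescoping: a termwise hypergeometric relation makes the whole terminating series a
solution. -/
lemma map_sum_eq_zero_of_telescoping {F : Type*} [Field F] (L : F[X] →ₗ[F] F[X])
    {g h w z : F[X]} (hg : g ≠ 0) (m : ℕ) (c : ℕ → F) (r : ℕ → ℕ) (t s : ℕ → F[X])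
    (hL : ∀ n ≤ m, g * L (s n) = h * ((n : F[X]) ^ 2 * w - r n * z) * t n)
    (ht : ∀ n < m, z * t n = w * t (n + 1))
    (hc : ∀ n < m, ((n : F) + 1) ^ 2 * c (n + 1) = r n * c n) (hr : (r m : F) = 0) :
    L (∑ n ∈ Finset.range (m + 1), C (c n) * s n) = 0 := by
  have hsum : ∀ k ≤ m, g * L (∑ n ∈ Finset.range (k + 1), C (c n) * s n) =
      - (h * (r k * C (c k) * z * t k)) := by
    intro k
    induction k with
    | zero =>
      intro hk
      have := hL 0 hk
      simp only [zero_add, Finset.sum_range_one, ← smul_eq_C_mul, map_smul, mul_smul_comm, this]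
      simp only [smul_eq_C_mul]
      push_cast
      ring
    | succ k ih =>
      intro hk
      rw [Finset.sum_range_succ, map_add, mul_add, ih (by omega), ← smul_eq_C_mul, map_smul,
        mul_smul_comm, hL _ hk, smul_eq_C_mul]
      have hc' := congrArg (C : F → F[X]) (hc k (by omega))
      simp only [map_mul, map_pow, map_add, map_natCast, map_one] at hc'
      have ht' := ht k (by omega)
      push_cast
      linear_combination h * w * t (k + 1) * hc' - h * r k * C (c k) * ht'
  have hm := hsum m le_rfl
  have hr' : (r m : F[X]) = 0 := by rw [← map_natCast C, hr, map_zero]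
  rw [hr'] at hm
  exact (mul_eq_zero.mp (hm.trans (by ring))).resolve_left hg

end Terms

section HeckeInvariance

/-- The polynomial `∑ cₙ f Xᵃⁿ w^(3(m-n))`: the pullback of `∑ cₙ X^(m-n)` along `w³ / Xᵃ`, with
denominators cleared and multiplied by `f`. -/
def pulledBackSum {F : Type*} [Field F] (c : ℕ → F) (m : ℕ) (f : F[X]) (a : ℕ) (w : F[X]) : F[X] :=
  ∑ n ∈ Finset.range (m + 1), C (c n) * (f * (X ^ (a * n) * w ^ (3 * (m - n))))

lemma natDegree_pulledBackSum_le {F : Type*} [Field F] (c : ℕ → F) (m : ℕ) {f : F[X]} {a : ℕ}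
    {w : F[X]} {d : ℕ} (hf : f.natDegree ≤ d) (ha : a ≤ 3) (hw : w.natDegree ≤ 1) :
    (pulledBackSum c m f a w).natDegree ≤ 3 * m + d := by
  refine natDegree_sum_le_of_forall_le _ _ fun n hn => ?_
  have hn' : n ≤ m := by simpa [Nat.lt_succ_iff] using hn
  have h1 : (X ^ (a * n) : F[X]).natDegree ≤ 3 * n := by
    rw [natDegree_X_pow]; exact Nat.mul_le_mul_right n ha
  have h2 : (w ^ (3 * (m - n))).natDegree ≤ 3 * (m - n) * 1 := natDegree_pow_le_of_le _ hw
  refine (natDegree_C_mul_le _ _).trans ((natDegree_mul_le_of_le hf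
    (natDegree_mul_le_of_le h1 h2)).trans ?_)
  omega

lemma coeff_zero_pulledBackSum {F : Type*} [Field F] (c : ℕ → F) (m : ℕ) (f : F[X]) {a : ℕ}
    (ha : a ≠ 0) (w : F[X]) :
    (pulledBackSum c m f a w).coeff 0 = c 0 * (f.eval 0 * w.eval 0 ^ (3 * m)) := by
  rw [coeff_zero_eq_eval_zero, pulledBackSum, eval_finsetSum,
    Finset.sum_eq_single_of_mem 0 (by simp)]
  · simp
  · intro n _ hn
    simp [zero_pow (mul_ne_zero ha hn)]

lemma aeval_pulledBackSum {F K : Type*} [Field F] [Field K] [Algebra F K] (c : ℕ → F) (m : ℕ)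
    (f : F[X]) (a : ℕ) (w : F[X]) {v x : K} (h : x * v ^ a = aeval v w ^ 3) :
    aeval v (pulledBackSum c m f a w) =
      aeval v f * ((v ^ a) ^ m * aeval x (∑ n ∈ Finset.range (m + 1), C (c n) * X ^ (m - n))) := by
  simp only [pulledBackSum, map_sum, map_mul, map_pow, aeval_X, aeval_C, Finset.mul_sum]
  refine Finset.sum_congr rfl fun n hn => ?_
  have hn' : n ≤ m := by simpa [Nat.lt_succ_iff] using hn
  rw [pow_mul (aeval v w), ← h, mul_pow, pow_mul]
  obtain ⟨k, rfl⟩ := Nat.exists_eq_add_of_le hn'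
  rw [Nat.add_sub_cancel_left, pow_add (v ^ a)]
  ring

lemma pulledBackSum_proportional {p : ℕ} [Fact p.Prime] (hp : 5 ≤ p) (b₂ b₁ e₁ e₀ : ℕ)
    {y z : (ZMod p)[X]} (hy : y.natDegree < p) (hz : z.natDegree < p)
    (hLy : secondOrderOp (4 * X ^ 3 + 80 * X ^ 2 + 256 * X)
      ((b₂ : (ZMod p)[X]) * X ^ 2 + (b₁ : (ZMod p)[X]) * X + 256)
      ((e₁ : (ZMod p)[X]) * X + (e₀ : (ZMod p)[X])) y = 0)
    (hLz : secondOrderOp (4 * X ^ 3 + 80 * X ^ 2 + 256 * X)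
      ((b₂ : (ZMod p)[X]) * X ^ 2 + (b₁ : (ZMod p)[X]) * X + 256)
      ((e₁ : (ZMod p)[X]) * X + (e₀ : (ZMod p)[X])) z = 0) :
    C (z.coeff 0) * y = C (y.coeff 0) * z := by
  have h2 : (2 : ZMod p) ≠ 0 := by
    have : ((2 : ℕ) : ZMod p) ≠ 0 := by
      rw [Ne, ZMod.natCast_eq_zero_iff]
      exact fun h => absurd (Nat.le_of_dvd (by norm_num) h) (by omega)
    simpa using this
  rw [← sub_eq_zero]
  refine eq_zero_of_secondOrderOp_eq_zero (p := p) h2 b₂ b₁ e₁ e₀ ?_ ?_ ?_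
  · exact (natDegree_sub_le_of_le (natDegree_C_mul_le _ _) (natDegree_C_mul_le _ _)).trans_lt
      (max_lt hy hz)
  · simp [mul_comm]
  · simp only [map_natCast]
    rw [map_sub, ← smul_eq_C_mul, ← smul_eq_C_mul, map_smul, map_smul, hLy, hLz]
    simp

lemma natCast_ne_zero_of_pos_of_lt {p n : ℕ} (h0 : 0 < n) (h : n < p) : (n : ZMod p) ≠ 0 := by
  rw [Ne, ZMod.natCast_eq_zero_iff]
  exact fun hd => absurd (Nat.le_of_dvd h0 hd) (by omega)

/-- If `cₙ` satisfies the hypergeometric recurrence of the level 3 supersingular polynomial, the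
two pullbacks along the 2-isogeny correspondence are proportional. -/
lemma pulledBackSum_eq_one_mod {p m : ℕ} [Fact p.Prime] (hp : 5 ≤ p) (hm : p = 6 * m + 1)
    (c : ℕ → ZMod p)
    (hc : ∀ n < m, ((n : ZMod p) + 1) ^ 2 * c (n + 1) =
      ((6 * (6 * n + 1) * (3 * n + 1) : ℕ) : ZMod p) * c n) :
    C ((pulledBackSum c m 1 2 (X + 16)).coeff 0) * pulledBackSum c m 1 1 (X + 4) =
      C ((pulledBackSum c m 1 1 (X + 4)).coeff 0) * pulledBackSum c m 1 2 (X + 16) := by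
  have he : ∀ n ≤ m, (2 * ((3 * (m - n) : ℕ) : (ZMod p)[X]) + 1 + 6 * n) = 0 := by
    intro n hn
    have : 2 * (3 * (m - n)) + 1 + 6 * n = p := by omega
    have h := congrArg (Nat.cast : ℕ → (ZMod p)[X]) this
    rw [CharP.cast_eq_zero (ZMod p)[X] p] at h
    rw [← h]
    push_cast; ring
  have hr : ((6 * (6 * m + 1) * (3 * m + 1) : ℕ) : ZMod p) = 0 := by
    rw [← hm]; simp
  have hX4 : (X + 4 : (ZMod p)[X]).natDegree ≤ 1 := (natDegree_X_add_C (4 : ZMod p)).le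
  have hX16 : (X + 16 : (ZMod p)[X]).natDegree ≤ 1 := (natDegree_X_add_C (16 : ZMod p)).le
  have hX4' : (X + 4 : (ZMod p)[X]) ≠ 0 := X_add_C_ne_zero (4 : ZMod p)
  have hX16' : (X + 16 : (ZMod p)[X]) ≠ 0 := X_add_C_ne_zero (16 : ZMod p)
  refine pulledBackSum_proportional hp 8 120 1 8
    ((natDegree_pulledBackSum_le c m (d := 0) (by simp) (by norm_num) hX4).trans_lt (by omega))
    ((natDegree_pulledBackSum_le c m (d := 0) (by simp) (by norm_num) hX16).trans_lt (by omega))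
    ?_ ?_
  · refine map_sum_eq_zero_of_telescoping _ (mul_ne_zero X_ne_zero hX4') m c
      (h := 16) (w := (X + 4) ^ 3) (z := X)
      (fun n => 6 * (6 * n + 1) * (3 * n + 1)) (fun n => X ^ n * (X + 4) ^ (3 * (m - n))) _
      ?_ ?_ hc hr
    · intro n hn
      have := secondOrderOp_monomial_mul_add_four n _ (he n hn)
      push_cast at this ⊢
      simpa only [one_mul] using this
    · intro n hn
      obtain ⟨k, rfl⟩ := Nat.exists_eq_add_of_lt hn
      rw [show n + k + 1 - n = k + 1 by omega, show n + k + 1 - (n + 1) = k by omega]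
      ring
  · refine map_sum_eq_zero_of_telescoping _ (mul_ne_zero X_ne_zero hX16') m c
      (h := 4) (w := (X + 16) ^ 3) (z := X ^ 2)
      (fun n => 6 * (6 * n + 1) * (3 * n + 1)) (fun n => X ^ (2 * n) * (X + 16) ^ (3 * (m - n))) _
      ?_ ?_ hc hr
    · intro n hn
      have := secondOrderOp_monomial_mul_add_sixteen n _ (he n hn)
      push_cast at this ⊢
      simpa only [one_mul] using this
    · intro n hn
      obtain ⟨k, rfl⟩ := Nat.exists_eq_add_of_lt hn
      rw [show n + k + 1 - n = k + 1 by omega, show n + k + 1 - (n + 1) = k by omega]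
      ring

lemma pulledBackSum_eq_five_mod {p m : ℕ} [Fact p.Prime] (hp : 5 ≤ p) (hm : p = 6 * m + 5)
    (c : ℕ → ZMod p)
    (hc : ∀ n < m, ((n : ZMod p) + 1) ^ 2 * c (n + 1) =
      ((6 * (6 * n + 5) * (3 * n + 2) : ℕ) : ZMod p) * c n) :
    C ((pulledBackSum c m (X - 32) 2 (X + 16)).coeff 0) * pulledBackSum c m (X - 2) 1 (X + 4) =
      C ((pulledBackSum c m (X - 2) 1 (X + 4)).coeff 0) *
        pulledBackSum c m (X - 32) 2 (X + 16) := by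
  have he : ∀ n ≤ m, (2 * ((3 * (m - n) : ℕ) : (ZMod p)[X]) + 5 + 6 * n) = 0 := by
    intro n hn
    have : 2 * (3 * (m - n)) + 5 + 6 * n = p := by omega
    have h := congrArg (Nat.cast : ℕ → (ZMod p)[X]) this
    rw [CharP.cast_eq_zero (ZMod p)[X] p] at h
    rw [← h]
    push_cast; ring
  have hr : ((6 * (6 * m + 5) * (3 * m + 2) : ℕ) : ZMod p) = 0 := by
    rw [← hm]; simp
  have hX4 : (X + 4 : (ZMod p)[X]).natDegree ≤ 1 := (natDegree_X_add_C (4 : ZMod p)).le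
  have hX16 : (X + 16 : (ZMod p)[X]).natDegree ≤ 1 := (natDegree_X_add_C (16 : ZMod p)).le
  have hX4' : (X + 4 : (ZMod p)[X]) ≠ 0 := X_add_C_ne_zero (4 : ZMod p)
  have hX16' : (X + 16 : (ZMod p)[X]) ≠ 0 := X_add_C_ne_zero (16 : ZMod p)
  refine pulledBackSum_proportional hp 16 200 9 48
    ((natDegree_pulledBackSum_le c m (natDegree_X_sub_C (2 : ZMod p)).le (by norm_num)
      hX4).trans_lt (by omega))
    ((natDegree_pulledBackSum_le c m (natDegree_X_sub_C (32 : ZMod p)).le (by norm_num)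
      hX16).trans_lt (by omega))
    ?_ ?_
  · refine map_sum_eq_zero_of_telescoping _ (mul_ne_zero X_ne_zero hX4') m c
      (h := 16 * (X - 2)) (w := (X + 4) ^ 3) (z := X)
      (fun n => 6 * (6 * n + 5) * (3 * n + 2)) (fun n => X ^ n * (X + 4) ^ (3 * (m - n))) _
      ?_ ?_ hc hr
    · intro n hn
      have := secondOrderOp_sub_two_mul_monomial n _ (he n hn)
      push_cast at this ⊢
      simpa only [one_mul] using this
    · intro n hn
      obtain ⟨k, rfl⟩ := Nat.exists_eq_add_of_lt hn
      rw [show n + k + 1 - n = k + 1 by omega, show n + k + 1 - (n + 1) = k by omega]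
      ring
  · refine map_sum_eq_zero_of_telescoping _ (mul_ne_zero X_ne_zero hX16') m c
      (h := 4 * (X - 32)) (w := (X + 16) ^ 3) (z := X ^ 2)
      (fun n => 6 * (6 * n + 5) * (3 * n + 2)) (fun n => X ^ (2 * n) * (X + 16) ^ (3 * (m - n))) _
      ?_ ?_ hc hr
    · intro n hn
      have := secondOrderOp_sub_thirtyTwo_mul_monomial n _ (he n hn)
      push_cast at this ⊢
      exact this
    · intro n hn
      obtain ⟨k, rfl⟩ := Nat.exists_eq_add_of_lt hn
      rw [show n + k + 1 - n = k + 1 by omega, show n + k + 1 - (n + 1) = k by omega]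
      ring

/-- The zero set of the level 3 hypergeometric polynomial is stable under 2-isogenies. -/
lemma aeval_eq_zero_of_two_isogeny {p m d : ℕ} [Fact p.Prime] (hp : 5 ≤ p) (hd : d ≤ 1)
    (hm : p = 6 * m + 1 + 4 * d) (c : ℕ → ZMod p) (hc0 : c 0 ≠ 0)
    (hc : ∀ n < m, ((n : ZMod p) + 1) ^ 2 * c (n + 1) =
      ((6 * (6 * n + 1 + 4 * d) * (3 * n + 1 + d) : ℕ) : ZMod p) * c n)
    {K : Type*} [Field K] [Algebra (ZMod p) K] {x y v : K} (hv : v ≠ 0)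
    (hxv : x * v = (v + 4) ^ 3) (hyv : y * v ^ 2 = (v + 16) ^ 3)
    (hx : aeval x (∑ n ∈ Finset.range (m + 1), C (c n) * X ^ (m - n)) = 0) :
    aeval y (∑ n ∈ Finset.range (m + 1), C (c n) * X ^ (m - n)) = 0 ∨ v = 32 := by
  have h2 : (2 : ZMod p) ≠ 0 := by
    simpa using natCast_ne_zero_of_pos_of_lt (p := p) (n := 2) (by norm_num) (by omega)
  have hpow : ∀ k : ℕ, (2 : ZMod p) ^ k ≠ 0 := fun k => pow_ne_zero k h2
  have h4 : (4 : ZMod p) ≠ 0 := by convert hpow 2 using 1; norm_num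
  have hxv' : x * v ^ 1 = aeval v (X + 4 : (ZMod p)[X]) ^ 3 := by simpa [map_ofNat] using hxv
  have hyv' : y * v ^ 2 = aeval v (X + 16 : (ZMod p)[X]) ^ 3 := by simpa [map_ofNat] using hyv
  interval_cases d
  · have h := congrArg (aeval v) (pulledBackSum_eq_one_mod hp hm c hc)
    rw [map_mul, map_mul, aeval_pulledBackSum c m 1 1 _ hxv', aeval_pulledBackSum c m 1 2 _ hyv',
      hx, coeff_zero_pulledBackSum c m 1 one_ne_zero] at h
    left
    simpa [hc0, hv, h4] using h
  · have h := congrArg (aeval v) (pulledBackSum_eq_five_mod hp hm c hc)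
    rw [map_mul, map_mul, aeval_pulledBackSum c m _ 1 _ hxv', aeval_pulledBackSum c m _ 2 _ hyv',
      hx, coeff_zero_pulledBackSum c m _ one_ne_zero] at h
    have h2' : (2 : K) ≠ 0 := by
      simpa [map_ofNat] using (_root_.map_ne_zero (algebraMap (ZMod p) K)).mpr h2
    have h4' : (4 : K) ≠ 0 := by
      simpa [map_ofNat] using (_root_.map_ne_zero (algebraMap (ZMod p) K)).mpr h4
    have h' : v - 32 = 0 ∨
        aeval y (∑ n ∈ Finset.range (m + 1), C (c n) * X ^ (m - n)) = 0 := by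
      simpa [hc0, hv, h4', h2', map_ofNat] using h
    exact h'.symm.imp_right sub_eq_zero.mp

end HeckeInvariance

section IsogenyGraph

lemma root_cubic_of_isogeny_parameter_not_mem_range {F K : Type*} [Field F] [Field K]
    [Algebra F K] (h2 : (2 : F) ≠ 0) (h63 : (63 : F) ≠ 0) {x y : F} {v : K}
    (hx : algebraMap F K x * v = (v + 4) ^ 3) (hy : algebraMap F K y * v ^ 2 = (v + 16) ^ 3)
    (hv : v ∉ Set.range (algebraMap F K)) :
    ∃ u : F, u ^ 3 - 12 * u ^ 2 + 12 * u - 1 = 0 ∧ u * x = 36 * u - 63 := by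
  have hv0 : v ≠ 0 := by
    rintro rfl
    exact hv ⟨0, map_zero _⟩
  have hlin : ∀ a b : F, algebraMap F K a * v + algebraMap F K b = 0 → a = 0 ∧ b = 0 := by
    intro a b h
    have ha : a = 0 := by
      by_contra ha
      have ha' : algebraMap F K a ≠ 0 := (_root_.map_ne_zero _).mpr ha
      refine hv ⟨-b / a, ?_⟩
      rw [map_div₀, map_neg, div_eq_iff ha']
      linear_combination -h
    refine ⟨ha, ?_⟩
    simpa [ha] using h
  obtain ⟨u, hu⟩ : ∃ u : F, 63 * u = 36 - y := ⟨(36 - y) / 63, by field_simp⟩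
  obtain ⟨w, hw⟩ : ∃ w : F, 63 * w = 720 + x := ⟨(720 + x) / 63, by field_simp⟩
  have hu' := congrArg (algebraMap F K) hu
  have hw' := congrArg (algebraMap F K) hw
  simp only [map_mul, map_sub, map_add, map_ofNat] at hu' hw'
  have h63' : (63 : K) ≠ 0 := by
    simpa [map_ofNat] using (_root_.map_ne_zero (algebraMap F K)).mpr h63
  have hq : algebraMap F K u * v ^ 2 + algebraMap F K w * v + 64 = 0 := by
    refine (mul_eq_zero.mp (?_ : (63 : K) * _ = 0)).resolve_left h63'
    linear_combination hx - hy + v ^ 2 * hu' + v * hw'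
  obtain ⟨hA, hB⟩ := hlin (12 * u - w - u ^ 2) (u * (48 - x) - 64 - u * w) (by
    simp only [map_sub, map_mul, map_pow, map_ofNat]
    refine (mul_eq_zero.mp (?_ : v * _ = 0)).resolve_left hv0
    linear_combination -algebraMap F K u * hx - (v + algebraMap F K u) * hq)
  have hC : u * (12 - w) - 1 = 0 := by
    refine (mul_eq_zero.mp (?_ : (2 : F) ^ 6 * _ = 0)).resolve_left (pow_ne_zero _ h2)
    linear_combination hB - u * hw
  exact ⟨u, by linear_combination hC - u * hA, by linear_combination -u * hw + 63 * (-hC)⟩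

lemma exists_exceptional_finset {F K : Type*} [Field F] [Field K] [Algebra F K]
    (h2 : (2 : F) ≠ 0) (h63 : (63 : F) ≠ 0) :
    ∃ E : Finset F, E.card ≤ 3 ∧ ∀ (x y : F) (v : K), algebraMap F K x * v = (v + 4) ^ 3 →
      algebraMap F K y * v ^ 2 = (v + 16) ^ 3 → v ∉ Set.range (algebraMap F K) → x ∈ E := by
  classical
  let P : F[X] := (⟨1, -12, 12, -1⟩ : Cubic F).toPoly
  have hP : P ≠ 0 := Cubic.ne_zero_of_a_ne_zero one_ne_zero
  refine ⟨P.roots.toFinset.image fun u => (36 * u - 63) / u, ?_, ?_⟩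
  · refine Finset.card_image_le.trans ((Multiset.toFinset_card_le _).trans ((card_roots' P).trans ?_))
    exact (Cubic.natDegree_of_a_ne_zero one_ne_zero).le
  · intro x y v hx hy hv
    obtain ⟨u, hu, hux⟩ := root_cubic_of_isogeny_parameter_not_mem_range h2 h63 hx hy hv
    have hu0 : u ≠ 0 := by
      rintro rfl
      norm_num at hu
    refine Finset.mem_image.mpr ⟨u, ?_, ?_⟩
    · rw [Multiset.mem_toFinset, mem_roots hP]
      simp only [P, Cubic.toPoly, IsRoot, eval_add, eval_mul, eval_C, eval_pow, eval_X]
      linear_combination hu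
    · rw [← hux, mul_div_cancel_left₀ x hu0]

lemma exists_finset_isogenous {F : Type*} [Field F] (E : Finset F) :
    ∃ N : Finset F, N.card ≤ 3 * E.card ∧ ∀ x y v : F, v ≠ 0 → y ∈ E →
      x * v = (v + 4) ^ 3 → y * v ^ 2 = (v + 16) ^ 3 → x ∈ N := by
  classical
  let P : F → F[X] := fun y => (⟨1, 48 - y, 768, 4096⟩ : Cubic F).toPoly
  refine ⟨E.biUnion fun y => (P y).roots.toFinset.image fun v => (v + 4) ^ 3 / v, ?_, ?_⟩
  · rw [mul_comm]
    refine Finset.card_biUnion_le_card_mul _ _ _ fun y _ => Finset.card_image_le.trans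
      ((Multiset.toFinset_card_le _).trans ((card_roots' _).trans ?_))
    exact (Cubic.natDegree_of_a_ne_zero one_ne_zero).le
  · intro x y v hv hy hxv hyv
    refine Finset.mem_biUnion.mpr ⟨y, hy, Finset.mem_image.mpr ⟨v, ?_, ?_⟩⟩
    · rw [Multiset.mem_toFinset, mem_roots (Cubic.ne_zero_of_a_ne_zero one_ne_zero)]
      simp only [Cubic.toPoly, IsRoot, eval_add, eval_mul, eval_C, eval_pow, eval_X]
      linear_combination -hyv
    · rw [← hxv, mul_div_cancel_right₀ x hv]

lemma exists_three_isogeny_parameters {F K : Type*} [Field F] [Field K] [IsAlgClosed K]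
    [Algebra F K] {x : F}
    (h : ∀ v : K, algebraMap F K x * v = (v + 4) ^ 3 → v ∈ Set.range (algebraMap F K)) :
    ∃ v₁ v₂ v₃ : F, v₁ + v₂ + v₃ = -12 ∧ v₁ * v₂ + v₁ * v₃ + v₂ * v₃ = 48 - x ∧
      v₁ * v₂ * v₃ = -64 := by
  let P : Cubic F := ⟨1, 12, 48 - x, 64⟩
  have ha : P.a ≠ 0 := one_ne_zero
  obtain ⟨r, s, t, hr⟩ := (Cubic.splits_iff_roots_eq_three (φ := algebraMap F K) ha).mp
    (IsAlgClosed.splits _)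
  have hb := Cubic.b_eq_three_roots ha hr
  have hc := Cubic.c_eq_three_roots ha hr
  have hd := Cubic.d_eq_three_roots ha hr
  simp only [P, map_one, one_mul, map_sub, map_ofNat] at hb hc hd
  obtain ⟨v₁, rfl⟩ := h r (by linear_combination r ^ 2 * (-hb) - r * hc - hd)
  obtain ⟨v₂, rfl⟩ := h s (by linear_combination s ^ 2 * (-hb) - s * hc - hd)
  obtain ⟨v₃, rfl⟩ := h t (by linear_combination t ^ 2 * (-hb) - t * hc - hd)
  have hi := (algebraMap F K).injective
  refine ⟨v₁, v₂, v₃, hi ?_, hi ?_, hi ?_⟩ <;>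
    simp only [map_add, map_mul, map_neg, map_sub, map_ofNat]
  · rw [hb, neg_neg]
  · exact hc.symm
  · rw [hd, neg_neg]

lemma isogeny_discriminant {F : Type*} [Field F] {x v₁ v₂ v₃ : F} (h₁ : v₁ + v₂ + v₃ = -12)
    (h₂ : v₁ * v₂ + v₁ * v₃ + v₂ * v₃ = 48 - x) (h₃ : v₁ * v₂ * v₃ = -64) :
    (2 * x) ^ 2 * (x - 108) = ((v₁ - v₂) * (v₁ - v₃) * (v₂ - v₃)) ^ 2 := by
  have h : ((v₁ - v₂) * (v₁ - v₃) * (v₂ - v₃)) ^ 2 =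
      (v₁ + v₂ + v₃) ^ 2 * (v₁ * v₂ + v₁ * v₃ + v₂ * v₃) ^ 2
        - 4 * (v₁ * v₂ + v₁ * v₃ + v₂ * v₃) ^ 3 - 4 * (v₁ + v₂ + v₃) ^ 3 * (v₁ * v₂ * v₃)
        + 18 * (v₁ + v₂ + v₃) * (v₁ * v₂ + v₁ * v₃ + v₂ * v₃) * (v₁ * v₂ * v₃)
        - 27 * (v₁ * v₂ * v₃) ^ 2 := by ring
  rw [h, h₁, h₂, h₃]
  ring

lemma isSquare_isogeny_parameter_add_four {F : Type*} [Field F] {y v : F}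
    (hyv : y * v ^ 2 = (v + 16) ^ 3) (hy : IsSquare (y - 108)) : IsSquare (v + 4) := by
  by_cases h : v = 32
  · exact ⟨6, by rw [h]; norm_num⟩
  · obtain ⟨s, hs⟩ := hy
    have h' : v - 32 ≠ 0 := sub_ne_zero.mpr h
    refine ⟨s * v / (v - 32), ?_⟩
    rw [div_mul_div_comm, eq_div_iff (mul_ne_zero h' h')]
    linear_combination -hyv + v ^ 2 * hs

end IsogenyGraph

section Counting

lemma card_circle_le {F : Type*} [Field F] [Fintype F] [DecidableEq F] (h2 : (2 : F) ≠ 0) :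
    (Finset.univ.filter fun s : F × F =>
      s.1 ^ 2 + s.2 ^ 2 = 4 ∧ s.1 ≠ 0 ∧ s.2 ≠ 0).card ≤ Fintype.card F := by
  refine Finset.card_le_card_of_injOn (fun s => s.1 / (2 - s.2)) (fun _ _ => Finset.mem_univ _) ?_
  rintro ⟨a, b⟩ hs ⟨a', b'⟩ hs' h
  simp only [Finset.coe_filter, Finset.mem_univ, true_and, Set.mem_ofPred_eq] at hs hs'
  obtain ⟨hs, ha, -⟩ := hs
  obtain ⟨hs', ha', -⟩ := hs'
  have hne : ∀ {a b : F}, a ^ 2 + b ^ 2 = 4 → a ≠ 0 → 2 - b ≠ 0 := by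
    intro a b h ha hb
    refine ha (pow_eq_zero_iff two_ne_zero |>.mp ?_)
    linear_combination h + (2 + b) * hb
  have hb := hne hs ha
  have hb' := hne hs' ha'
  rw [div_eq_div_iff hb hb'] at h
  have h4 : b = b' := by
    refine sub_eq_zero.mp ((mul_eq_zero.mp (?_ : (2 : F) ^ 2 * _ = 0)).resolve_left
      (pow_ne_zero _ h2))
    refine (mul_eq_zero.mp (?_ : ((2 - b) * (2 - b')) * _ = 0)).resolve_left (mul_ne_zero hb hb')
    linear_combination (a * (2 - b') + a' * (2 - b)) * h - (2 - b') ^ 2 * hs + (2 - b) ^ 2 * hs'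
  subst h4
  exact Prod.ext (mul_right_cancel₀ hb h) rfl

/-- Elements `x` all of whose three preimages `v` under `v ↦ (v + 4)³ / v` are such that `-v` and
`v + 4` are nonzero squares number at most `|F| / 12`. -/
lemma twelve_mul_card_le {F : Type*} [Field F] [Fintype F] [DecidableEq F] (h2 : (2 : F) ≠ 0)
    (G : Finset F)
    (hG : ∀ x ∈ G, ∃ V : Finset F, V.card = 3 ∧ ∀ v ∈ V, x * v = (v + 4) ^ 3 ∧
      ∃ a b : F, a ≠ 0 ∧ b ≠ 0 ∧ -v = a ^ 2 ∧ v + 4 = b ^ 2) :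
    12 * G.card ≤ Fintype.card F := by
  let S := Finset.univ.filter fun s : F × F => s.1 ^ 2 + s.2 ^ 2 = 4 ∧ s.1 ≠ 0 ∧ s.2 ≠ 0
  have hneg : ∀ a : F, a ≠ 0 → a ≠ -a := by
    intro a ha h
    refine ha ((mul_eq_zero.mp (?_ : (2 : F) * a = 0)).resolve_left h2)
    linear_combination h
  have h4 : 4 * (S.image fun s : F × F => -s.1 ^ 2).card ≤ S.card := by
    refine Finset.mul_card_image_le_card_of_maps_to (f := fun s : F × F => -s.1 ^ 2)
      (fun s hs => Finset.mem_image_of_mem (fun s : F × F => -s.1 ^ 2) hs) 4 ?_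
    intro v hv
    obtain ⟨⟨a, b⟩, hs, rfl⟩ := Finset.mem_image.mp hv
    obtain ⟨hs, ha, hb⟩ := (Finset.mem_filter.mp hs).2
    dsimp only at hs ha hb
    have hcard : ((({a, -a} : Finset F) ×ˢ ({b, -b} : Finset F))).card = 4 := by
      rw [Finset.card_product, Finset.card_pair (hneg a ha), Finset.card_pair (hneg b hb)]
    refine hcard.symm.le.trans (Finset.card_le_card ?_)
    rintro ⟨a', b'⟩ h
    simp only [Finset.mem_product, Finset.mem_insert, Finset.mem_singleton] at h
    simp only [S, Finset.mem_filter, Finset.mem_univ, true_and]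
    rcases h with ⟨rfl | rfl, rfl | rfl⟩ <;> simp [hs, ha, hb]
  have h3 : 3 * G.card ≤ ((S.image fun s : F × F => -s.1 ^ 2).filter fun v => (v + 4) ^ 3 / v ∈ G).card := by
    refine Finset.mul_card_image_le_card_of_maps_to (f := fun v => (v + 4) ^ 3 / v)
      (fun v hv => (Finset.mem_filter.mp hv).2) 3 ?_
    intro x hx
    obtain ⟨V, hV, h⟩ := hG x hx
    refine hV.symm.le.trans (Finset.card_le_card fun v hv => ?_)
    obtain ⟨hxv, a, b, ha, hb, hva, hvb⟩ := h v hv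
    have hv0 : v ≠ 0 := by
      rintro rfl
      exact ha (pow_eq_zero_iff two_ne_zero |>.mp (by simpa using hva.symm))
    have hdiv : (v + 4) ^ 3 / v = x := by rw [← hxv, mul_div_cancel_right₀ x hv0]
    refine Finset.mem_filter.mpr ⟨Finset.mem_filter.mpr ⟨Finset.mem_image.mpr ⟨(a, b), ?_, ?_⟩, ?_⟩,
      hdiv⟩
    · simp only [S, Finset.mem_filter, Finset.mem_univ, true_and]
      exact ⟨by linear_combination -hva - hvb, ha, hb⟩
    · simp [← hva]
    · rwa [hdiv]
  have := h3.trans (Finset.card_filter_le _ _)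
  have := card_circle_le h2
  change S.card ≤ _ at this
  omega

lemma twelve_mul_card_le_of_isogeny_closed {F K : Type*} [Field F] [Fintype F] [Field K]
    [IsAlgClosed K] [Algebra F K] (h2 : (2 : F) ≠ 0) (h63 : (63 : F) ≠ 0) (Z : Finset F)
    (h0 : (0 : F) ∉ Z)
    (hZ : ∀ x ∈ Z, ∀ v : K, algebraMap F K x * v = (v + 4) ^ 3 →
      ∃ y : F, (y = 108 ∨ y ∈ Z) ∧ algebraMap F K y * v ^ 2 = (v + 16) ^ 3) :
    12 * Z.card ≤ Fintype.card F + 156 := by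
  classical
  obtain ⟨E, hE, hE'⟩ := exists_exceptional_finset (K := K) h2 h63
  obtain ⟨N, hN, hN'⟩ := exists_finset_isogenous E
  have hsplit : ∀ x ∈ Z, x ∉ E → ∃ v₁ v₂ v₃ : F, v₁ + v₂ + v₃ = -12 ∧
      v₁ * v₂ + v₁ * v₃ + v₂ * v₃ = 48 - x ∧ v₁ * v₂ * v₃ = -64 := by
    intro x hx hxE
    refine exists_three_isogeny_parameters (K := K) fun v hv => ?_
    obtain ⟨y, -, hy⟩ := hZ x hx v hv
    by_contra h
    exact hxE (hE' x y v hv hy h)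
  have hx0 : ∀ x ∈ Z, 2 * x ≠ 0 := fun x hx =>
    mul_ne_zero h2 fun h => h0 (h ▸ hx)
  have hsq : ∀ x, x = 108 ∨ x ∈ Z → x ∉ E → IsSquare (x - 108) := by
    rintro x (rfl | hx) hxE
    · simp
    · obtain ⟨v₁, v₂, v₃, h₁, h₂, h₃⟩ := hsplit x hx hxE
      refine ⟨(v₁ - v₂) * (v₁ - v₃) * (v₂ - v₃) / (2 * x), ?_⟩
      rw [← sq, div_pow, ← isogeny_discriminant h₁ h₂ h₃,
        mul_div_cancel_left₀ _ (pow_ne_zero 2 (hx0 x hx))]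
  have hgood : 12 * (Z \ (insert 108 (E ∪ N))).card ≤ Fintype.card F := by
    refine twelve_mul_card_le h2 _ fun x hx => ?_
    simp only [Finset.mem_sdiff, Finset.mem_insert, Finset.mem_union, not_or] at hx
    obtain ⟨hxZ, hx108, hxE, hxN⟩ := hx
    obtain ⟨v₁, v₂, v₃, h₁, h₂, h₃⟩ := hsplit x hxZ hxE
    have hdisc := isogeny_discriminant h₁ h₂ h₃
    have hne : (v₁ - v₂) * (v₁ - v₃) * (v₂ - v₃) ≠ 0 := by
      intro h
      rw [h, zero_pow two_ne_zero] at hdisc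
      exact mul_ne_zero (pow_ne_zero 2 (hx0 x hxZ)) (sub_ne_zero.mpr hx108) hdisc
    simp only [ne_eq, mul_eq_zero, sub_eq_zero, not_or] at hne
    have hx' : x ≠ 0 := right_ne_zero_of_mul (hx0 x hxZ)
    have h4 : (4 : F) ≠ 0 := by
      have := mul_ne_zero h2 h2
      norm_num at this
      exact this
    have hv0 : ∀ v, x * v = (v + 4) ^ 3 → v ≠ 0 := by
      rintro v hv rfl
      exact pow_ne_zero 3 h4 (by linear_combination -hv)
    have hb : ∀ v, x * v = (v + 4) ^ 3 → ∃ b, b ≠ 0 ∧ v + 4 = b ^ 2 := by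
      intro v hv
      have hvK : algebraMap F K x * algebraMap F K v = (algebraMap F K v + 4) ^ 3 := by
        simpa [map_ofNat] using congrArg (algebraMap F K) hv
      obtain ⟨y, hy, hyv⟩ := hZ x hxZ _ hvK
      have hyF : y * v ^ 2 = (v + 16) ^ 3 :=
        (algebraMap F K).injective (by simpa [map_ofNat] using hyv)
      have hyE : y ∉ E := fun h => hxN (hN' x y v (hv0 v hv) h hv hyF)
      obtain ⟨b, hb⟩ := isSquare_isogeny_parameter_add_four hyF (hsq y hy hyE)
      refine ⟨b, ?_, by rw [hb, sq]⟩
      rintro rfl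
      rw [hb] at hv
      exact mul_ne_zero hx' (hv0 v (hv.trans (by simp [hb]))) (by simpa using hv)
    have hr : ∀ v ∈ ({v₁, v₂, v₃} : Finset F), x * v = (v + 4) ^ 3 := by
      intro v hv
      simp only [Finset.mem_insert, Finset.mem_singleton] at hv
      rcases hv with rfl | rfl | rfl
      · linear_combination -v ^ 2 * h₁ + v * h₂ - h₃
      · linear_combination -v ^ 2 * h₁ + v * h₂ - h₃
      · linear_combination -v ^ 2 * h₁ + v * h₂ - h₃
    obtain ⟨b₁, hb₁, hvb₁⟩ := hb v₁ (hr _ (by simp))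
    obtain ⟨b₂, hb₂, hvb₂⟩ := hb v₂ (hr _ (by simp))
    obtain ⟨b₃, hb₃, hvb₃⟩ := hb v₃ (hr _ (by simp))
    have hprod : (b₁ * b₂ * b₃) ^ 2 = -4 * x := by
      rw [mul_pow, mul_pow, ← hvb₁, ← hvb₂, ← hvb₃]
      linear_combination 16 * h₁ + 4 * h₂ + h₃
    refine ⟨{v₁, v₂, v₃}, ?_, fun v hv => ⟨hr v hv, ?_⟩⟩
    · exact Finset.card_eq_three.mpr ⟨v₁, v₂, v₃, hne.1.1, hne.1.2, hne.2, rfl⟩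
    · obtain ⟨b, hb0, hvb⟩ := hb v (hr v hv)
      refine ⟨2 * b ^ 3 / (b₁ * b₂ * b₃), b,
        div_ne_zero (mul_ne_zero h2 (pow_ne_zero 3 hb0)) (mul_ne_zero (mul_ne_zero hb₁ hb₂) hb₃),
        hb0, ?_, hvb⟩
      rw [div_pow, hprod, eq_div_iff (mul_ne_zero (neg_ne_zero.mpr h4) hx')]
      have := hr v hv
      rw [hvb] at this
      linear_combination 4 * this
  have h1 := Finset.card_le_card_sdiff_add_card (s := Z) (t := insert 108 (E ∪ N))
  have h2' := Finset.card_insert_le 108 (E ∪ N)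
  have h3 := Finset.card_union_le E N
  omega

end Counting

section SupersingularPolynomial

lemma legendreSym_neg_three_eq {p : ℕ} [Fact p.Prime] (hp : 5 ≤ p) :
    legendreSym p (-3) = legendreSym 3 p := by
  have h2 : p ≠ 2 := by omega
  have hp2 : p % 2 = 1 := (Fact.out : p.Prime).mod_two_eq_one_iff_ne_two.mpr h2
  rw [show (-3 : ℤ) = -1 * (3 : ℕ) by norm_num, legendreSym.mul, legendreSym.at_neg_one h2]
  rcases (by omega : p % 4 = 1 ∨ p % 4 = 3) with h | h
  · rw [ZMod.χ₄_nat_one_mod_four h, one_mul,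
      legendreSym.quadratic_reciprocity_one_mod_four h (by norm_num)]
  · rw [ZMod.χ₄_nat_three_mod_four h,
      legendreSym.quadratic_reciprocity_three_mod_four (p := p) (q := 3) h rfl, neg_one_mul]

lemma del_eq {p : ℕ} [Fact p.Prime] (hp : 5 ≤ p) : del p = p % 3 - 1 := by
  rw [del, legendreSym_neg_three_eq hp, legendreSym.mod]
  have h3 : p % 3 ≠ 0 := fun h => by
    have := (Nat.prime_dvd_prime_iff_eq Nat.prime_three Fact.out).mp (Nat.dvd_of_mod_eq_zero h)
    omega
  norm_cast
  rcases (by omega : p % 3 = 1 ∨ p % 3 = 2) with h | h <;> rw [h] <;> decide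

lemma eq_six_mul_div_add {p : ℕ} [Fact p.Prime] (hp : 5 ≤ p) :
    p = 6 * (p / 6) + 1 + 4 * del p := by
  have hp' : p.Prime := Fact.out
  have h2 : p % 2 = 1 := hp'.mod_two_eq_one_iff_ne_two.mpr (by omega)
  have h3 : p % 3 ≠ 0 := fun h => by
    have := (Nat.prime_dvd_prime_iff_eq Nat.prime_three hp').mp (Nat.dvd_of_mod_eq_zero h)
    omega
  rw [del_eq hp]
  omega

/-- The coefficients of the hypergeometric factor of `ss3Star`. -/
def ss3Coeff (p : ℕ) [Fact p.Prime] (n : ℕ) : ZMod p :=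
  poch p (-(p / 6 : ℕ) : ZMod p) n * poch p ((1 : ZMod p) / 3 + (del p : ZMod p) / 3) n /
    ((n.factorial : ZMod p)) ^ 2 * 108 ^ n

/-- The hypergeometric factor of `ss3Star`, without its zero at the origin. -/
def ss3Factor (p : ℕ) [Fact p.Prime] : (ZMod p)[X] :=
  ∑ n ∈ Finset.range (p / 6 + 1), C (ss3Coeff p n) * X ^ (p / 6 - n)

lemma ss3Star_eq (p : ℕ) [Fact p.Prime] :
    ss3Star p = ((X - C 108) * X) ^ del p * ss3Factor p := by
  rw [ss3Star, mul_pow, mul_assoc, ss3Factor]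
  congr 1
  rw [Finset.mul_sum]
  refine Finset.sum_congr rfl fun n hn => ?_
  have hn' : n ≤ p / 6 := by simpa [Nat.lt_succ_iff] using hn
  rw [show p / 6 + del p - n = del p + (p / 6 - n) by omega, pow_add, ss3Coeff]
  ring

lemma ss3Coeff_zero (p : ℕ) [Fact p.Prime] : ss3Coeff p 0 = 1 := by
  simp [ss3Coeff, poch]

lemma natCast_factorial_ne_zero {p n : ℕ} [Fact p.Prime] (h : n < p) :
    (n.factorial : ZMod p) ≠ 0 := by
  rw [Ne, ZMod.natCast_eq_zero_iff, (Fact.out : p.Prime).dvd_factorial]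
  omega

lemma ss3Coeff_succ {p : ℕ} [Fact p.Prime] (hp : 5 ≤ p) {n : ℕ} (hn : n < p / 6) :
    ((n : ZMod p) + 1) ^ 2 * ss3Coeff p (n + 1) =
      (coeffRatioNum (del p) n : ZMod p) * ss3Coeff p n := by
  have h3 : (3 : ZMod p) ≠ 0 := by
    simpa using natCast_ne_zero_of_pos_of_lt (p := p) (n := 3) (by norm_num) (by omega)
  have hn1 : (n : ZMod p) + 1 ≠ 0 := by
    simpa using natCast_ne_zero_of_pos_of_lt (p := p) (n := n + 1) (by omega) (by omega)
  have hf : (n.factorial : ZMod p) ≠ 0 := natCast_factorial_ne_zero (by omega)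
  have hm : 6 * ((p / 6 : ℕ) : ZMod p) + 1 + 4 * (del p : ZMod p) = 0 := by
    have h := congrArg (Nat.cast : ℕ → ZMod p) (eq_six_mul_div_add hp)
    rw [CharP.cast_eq_zero (ZMod p) p] at h
    push_cast at h
    exact h.symm
  have hsucc : ∀ x : ZMod p, poch p x (n + 1) = poch p x n * (x + n) := fun x => by
    simp [poch, ascPochhammer_succ_eval]
  obtain ⟨β, hβ⟩ : ∃ β : ZMod p, β = 1 / 3 + (del p : ZMod p) / 3 := ⟨_, rfl⟩
  have hβ3 : 3 * β = 1 + del p := by rw [hβ]; field_simp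
  rw [ss3Coeff, ss3Coeff, ← hβ, hsucc, hsucc, Nat.factorial_succ, coeffRatioNum]
  push_cast
  field_simp
  linear_combination poch p (-(p / 6 : ℕ)) n * poch p β n * 108 ^ n * 6 *
    ((6 * n - 6 * (p / 6 : ℕ)) * hβ3 - (3 * n + 1 + del p) * hm)

lemma ss3Coeff_ne_zero {p : ℕ} [Fact p.Prime] (hp : 5 ≤ p) {n : ℕ} (hn : n ≤ p / 6) :
    ss3Coeff p n ≠ 0 := by
  induction n with
  | zero => simp [ss3Coeff_zero]
  | succ n ih =>
    refine right_ne_zero_of_mul (a := ((n : ZMod p) + 1) ^ 2) ?_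
    rw [ss3Coeff_succ hp hn, coeffRatioNum]
    have hp6 := eq_six_mul_div_add hp
    have h2 := natCast_ne_zero_of_pos_of_lt (p := p) (n := 2) (by norm_num) (by omega)
    have h3 := natCast_ne_zero_of_pos_of_lt (p := p) (n := 3) (by norm_num) (by omega)
    have h4 := natCast_ne_zero_of_pos_of_lt (p := p) (n := 6 * n + 1 + 4 * del p) (by omega)
      (by omega)
    have h5 := natCast_ne_zero_of_pos_of_lt (p := p) (n := 3 * n + 1 + del p) (by omega)
      (by omega)
    rw [show 6 * (6 * n + 1 + 4 * del p) * (3 * n + 1 + del p) =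
      2 * 3 * (6 * n + 1 + 4 * del p) * (3 * n + 1 + del p) by ring]
    simp only [Nat.cast_mul 2 3, Nat.cast_mul _ (3 * n + 1 + del p), Nat.cast_mul (2 * 3)]
    exact mul_ne_zero (mul_ne_zero (mul_ne_zero (mul_ne_zero h2 h3) h4) h5) (ih (by omega))

lemma natDegree_ss3Factor (p : ℕ) [Fact p.Prime] : (ss3Factor p).natDegree = p / 6 := by
  refine natDegree_eq_of_le_of_coeff_ne_zero ?_ (?_ : (ss3Factor p).coeff (p / 6) ≠ 0)
  · refine natDegree_sum_le_of_forall_le _ _ fun n _ => ?_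
    exact (natDegree_C_mul_X_pow_le _ _).trans (Nat.sub_le _ _)
  · rw [ss3Factor, finsetSum_coeff, Finset.sum_eq_single_of_mem 0 (by simp)]
    · simp [ss3Coeff_zero]
    · intro n hn hn0
      have hn' : n ≤ p / 6 := by simpa [Nat.lt_succ_iff] using hn
      rw [coeff_C_mul_X_pow, if_neg (by omega)]

lemma ss3Factor_ne_zero (p : ℕ) [Fact p.Prime] : ss3Factor p ≠ 0 := by
  intro h
  have h0 : (ss3Factor p).coeff (p / 6) = 0 := by rw [h, coeff_zero]
  rw [ss3Factor, finsetSum_coeff, Finset.sum_eq_single_of_mem 0 (by simp)] at h0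
  · simp [ss3Coeff_zero] at h0
  · intro n hn hn0
    have hn' : n ≤ p / 6 := by simpa [Nat.lt_succ_iff] using hn
    rw [coeff_C_mul_X_pow, if_neg (by omega)]

lemma eval_zero_ss3Factor_ne_zero {p : ℕ} [Fact p.Prime] (hp : 5 ≤ p) :
    (ss3Factor p).eval 0 ≠ 0 := by
  rw [ss3Factor, eval_finsetSum, Finset.sum_eq_single_of_mem (p / 6) (by simp)]
  · simpa using ss3Coeff_ne_zero hp le_rfl
  · intro n hn hn0
    have hn' : n ≤ p / 6 := by simpa [Nat.lt_succ_iff] using hn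
    simp [zero_pow (by omega : p / 6 - n ≠ 0)]

lemma ss3Star_ne_zero (p : ℕ) [Fact p.Prime] : ss3Star p ≠ 0 := by
  rw [ss3Star_eq]
  exact mul_ne_zero (pow_ne_zero _ (mul_ne_zero (X_sub_C_ne_zero _) X_ne_zero))
    (ss3Factor_ne_zero p)

lemma natDegree_ss3Star (p : ℕ) [Fact p.Prime] :
    (ss3Star p).natDegree = p / 6 + 2 * del p := by
  have hX : (X - C 108 : (ZMod p)[X]) * X ≠ 0 := mul_ne_zero (X_sub_C_ne_zero _) X_ne_zero
  rw [ss3Star_eq, natDegree_mul (pow_ne_zero _ hX) (ss3Factor_ne_zero p), natDegree_pow,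
    natDegree_mul (X_sub_C_ne_zero _) X_ne_zero, natDegree_X_sub_C, natDegree_X,
    natDegree_ss3Factor]
  omega

lemma natCast_hornerPair {p : ℕ} [Fact p.Prime] (hp : 5 ≤ p) (x : ℕ) {n : ℕ} (hn : n ≤ p / 6) :
    ((hornerPair p (del p) x n).1 : ZMod p) = (n.factorial : ZMod p) ^ 2 * ss3Coeff p n ∧
    ((hornerPair p (del p) x n).2 : ZMod p) = (n.factorial : ZMod p) ^ 2 *
      ∑ j ∈ Finset.range (n + 1), ss3Coeff p j * (x : ZMod p) ^ (n - j) := by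
  induction n with
  | zero => simp [hornerPair, ss3Coeff_zero]
  | succ n ih =>
    obtain ⟨h1, h2⟩ := ih (by omega)
    have hsum : ∑ j ∈ Finset.range (n + 1 + 1), ss3Coeff p j * (x : ZMod p) ^ (n + 1 - j) =
        x * (∑ j ∈ Finset.range (n + 1), ss3Coeff p j * (x : ZMod p) ^ (n - j)) +
          ss3Coeff p (n + 1) := by
      rw [Finset.sum_range_succ, Nat.sub_self, pow_zero, mul_one, Finset.mul_sum]
      congr 1
      refine Finset.sum_congr rfl fun j hj => ?_
      rw [show n + 1 - j = n - j + 1 by have := Finset.mem_range.mp hj; omega]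
      ring
    have hc := ss3Coeff_succ hp (n := n) hn
    simp only [hornerPair, ZMod.natCast_mod, Nat.cast_mul, Nat.cast_add, Nat.cast_pow,
      Nat.factorial_succ, h1, h2, hsum, Nat.cast_one]
    constructor
    · linear_combination -(n.factorial : ZMod p) ^ 2 * hc
    · linear_combination -(n.factorial : ZMod p) ^ 2 * hc

lemma rootTest_iff {p : ℕ} [Fact p.Prime] (hp : 5 ≤ p) (x : ℕ) :
    rootTest p (del p) x = true ↔ (ss3Star p).eval (x : ZMod p) = 0 := by
  have hf : (((p / 6).factorial : ZMod p)) ^ 2 ≠ 0 :=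
    pow_ne_zero 2 (natCast_factorial_ne_zero (by omega))
  rw [rootTest, beq_iff_eq, ← Nat.dvd_iff_mod_eq_zero, ← ZMod.natCast_eq_zero_iff]
  simp only [Nat.cast_mul, Nat.cast_pow, Nat.cast_add, (natCast_hornerPair hp x le_rfl).2,
    Nat.cast_sub (by omega : 1 ≤ p), CharP.cast_eq_zero, Nat.cast_one]
  rw [ss3Star_eq, ss3Factor, mul_left_comm, mul_eq_zero, or_iff_right hf]
  simp only [eval_mul, eval_pow, eval_sub, eval_X, eval_C, eval_finsetSum]
  rw [show (x : ZMod p) * (x + (108 : ℕ) * (0 - 1)) = (x - 108) * x by push_cast; ring]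

lemma L3Star_eq_rootCount {p : ℕ} [Fact p.Prime] (hp : 5 ≤ p) :
    L3Star p = rootCount p (del p) := by
  have h : rootCount p (del p) =
      ((Finset.range p).filter fun x => rootTest p (del p) x = true).card := by
    rw [rootCount, ← Nat.count_eq_card_filter_range, Nat.count]
    simp
  rw [h, L3Star]
  symm
  refine Finset.card_bij (fun x _ => (x : ZMod p)) ?_ ?_ ?_
  · intro x hx
    rw [Multiset.mem_toFinset, mem_roots (ss3Star_ne_zero p), IsRoot, ← rootTest_iff hp]
    exact (Finset.mem_filter.mp hx).2
  · intro x hx y hy hxy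
    have hx' := Finset.mem_range.mp (Finset.mem_filter.mp hx).1
    have hy' := Finset.mem_range.mp (Finset.mem_filter.mp hy).1
    exact ((ZMod.natCast_eq_natCast_iff _ _ _).mp hxy).eq_of_lt_of_lt hx' hy'
  · intro x hx
    refine ⟨x.val, Finset.mem_filter.mpr ⟨Finset.mem_range.mpr x.val_lt, ?_⟩,
      ZMod.natCast_zmod_val x⟩
    rw [rootTest_iff hp, ZMod.natCast_zmod_val]
    exact (mem_roots (ss3Star_ne_zero p)).mp (Multiset.mem_toFinset.mp hx)

/-- If all roots of the level 3 supersingular polynomial are rational then `p` is small. -/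
lemma lt_of_natDegree_ss3Star_eq_L3Star {p : ℕ} [Fact p.Prime] (hp : 11 ≤ p)
    (h : (ss3Star p).natDegree = L3Star p) : p < 167 := by
  have hp5 : 5 ≤ p := by omega
  have hne := ss3Star_ne_zero p
  have hle : L3Star p ≤ (ss3Star p).roots.card := Multiset.toFinset_card_le _
  have hcard : (ss3Star p).roots.card = (ss3Star p).natDegree :=
    le_antisymm (card_roots' _) (h ▸ hle)
  have hnodup : (ss3Star p).roots.Nodup := by
    rw [← Multiset.toFinset_card_eq_card_iff_nodup, hcard, h, L3Star]
  have hdvd : ss3Factor p ∣ ss3Star p := ⟨_, (ss3Star_eq p).trans (mul_comm _ _)⟩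
  have hsplits : (ss3Factor p).Splits :=
    (splits_iff_card_roots.mpr hcard).of_dvd hne hdvd
  have hZ : (ss3Factor p).roots.toFinset.card = p / 6 := by
    rw [Multiset.toFinset_card_of_nodup (Multiset.nodup_of_le (roots.le_of_dvd hne hdvd) hnodup),
      ← hsplits.natDegree_eq_card_roots, natDegree_ss3Factor]
  have hmem : ∀ x, x ∈ (ss3Factor p).roots.toFinset ↔ (ss3Factor p).eval x = 0 := fun x => by
    rw [Multiset.mem_toFinset, mem_roots (ss3Factor_ne_zero p), IsRoot]
  have h2 : (2 : ZMod p) ≠ 0 := by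
    simpa using natCast_ne_zero_of_pos_of_lt (p := p) (n := 2) (by norm_num) (by omega)
  have h3 : (3 : ZMod p) ≠ 0 := by
    simpa using natCast_ne_zero_of_pos_of_lt (p := p) (n := 3) (by norm_num) (by omega)
  have h7 : (7 : ZMod p) ≠ 0 := by
    simpa using natCast_ne_zero_of_pos_of_lt (p := p) (n := 7) (by norm_num) (by omega)
  have h63 : (63 : ZMod p) ≠ 0 := by
    convert mul_ne_zero (pow_ne_zero 2 h3) h7 using 1
    norm_num
  let K := AlgebraicClosure (ZMod p)
  have h2K : (2 : K) ≠ 0 := by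
    simpa [map_ofNat] using (_root_.map_ne_zero (algebraMap (ZMod p) K)).mpr h2
  have hbound := twelve_mul_card_le_of_isogeny_closed (K := K) h2 h63
    (ss3Factor p).roots.toFinset (fun h0 => eval_zero_ss3Factor_ne_zero hp5 ((hmem 0).mp h0)) (by
      intro x hx v hv
      have hv0 : v ≠ 0 := by
        rintro rfl
        refine pow_ne_zero 6 h2K ?_
        linear_combination -hv
      have hxK : aeval (algebraMap (ZMod p) K x) (ss3Factor p) = 0 := by
        rw [aeval_algebraMap_apply, aeval_def, Algebra.algebraMap_self, eval₂_id,
          (hmem x).mp hx, map_zero]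
      rcases aeval_eq_zero_of_two_isogeny hp5 (by have := eq_six_mul_div_add hp5; omega)
        (eq_six_mul_div_add hp5) (ss3Coeff p) (by simp [ss3Coeff_zero])
        (fun n hn => ss3Coeff_succ hp5 hn) hv0 hv
        (div_mul_cancel₀ ((v + 16) ^ 3) (pow_ne_zero 2 hv0)) hxK with hy | rfl
      · change aeval _ (ss3Factor p) = 0 at hy
        obtain ⟨y, hy'⟩ := hsplits.mem_range_of_isRoot (ss3Factor_ne_zero p)
          ((eval_map_algebraMap (ss3Factor p) _).trans hy)
        refine ⟨y, Or.inr ((hmem y).mpr ?_), ?_⟩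
        · refine (_root_.map_eq_zero (algebraMap (ZMod p) K)).mp ?_
          rw [← eval₂_at_apply, ← aeval_def, hy']
          exact hy
        · rw [hy']
          exact div_mul_cancel₀ ((v + 16) ^ 3) (pow_ne_zero 2 hv0)
      · exact ⟨108, Or.inl rfl, by rw [map_ofNat]; norm_num⟩)
  rw [hZ, ZMod.card] at hbound
  have hlt := eq_six_mul_div_add hp5
  have hdel := del_eq hp5
  omega

end SupersingularPolynomial

/-- For every prime p ≥ 5, deg ss_p^{(3*)}(X) = L^{(3*)}(p) if and only if p divides the
order of Fischer's sporadic group Fi′₂₄. -/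
theorem deg_ss3star_eq_L3star_iff_dvd_fischer24 (hp : 5 ≤ p) :
    (ss3Star p).natDegree = L3Star p ↔ p ∣ fischer24Order := by
  have hsmall : p < 167 →
      ((ss3Star p).natDegree = L3Star p ↔ p ∣ fischer24Order) := fun h => by
    rw [natDegree_ss3Star, L3Star_eq_rootCount hp, del_eq hp]
    exact degree_eq_rootCount_iff_of_lt p (List.mem_range.mpr h) hp Fact.out
  refine ⟨fun h => ?_, fun h => (hsmall ?_).mpr h⟩
  · rcases lt_or_ge p 11 with hlt | hge
    · exact (hsmall (by omega)).mp h
    · exact (hsmall (lt_of_natDegree_ss3Star_eq_L3Star hge h)).mp h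
  · have hp' : p.Prime := Fact.out
    simp only [fischer24Order, hp'.dvd_mul] at h
    have hpow : ∀ {a n : ℕ}, p ∣ a ^ n → 0 < a → a < 167 → p < 167 := fun h h0 hlt =>
      (Nat.le_of_dvd h0 (hp'.dvd_of_dvd_pow h)).trans_lt hlt
    have hle : ∀ {a : ℕ}, p ∣ a → 0 < a → a < 167 → p < 167 := fun h h0 hlt =>
      (Nat.le_of_dvd h0 h).trans_lt hlt
    rcases h with (((((((h | h) | h) | h) | h) | h) | h) | h) | h
    · exact hpow h (by norm_num) (by norm_num)
    · exact hpow h (by norm_num) (by norm_num)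
    · exact hpow h (by norm_num) (by norm_num)
    · exact hpow h (by norm_num) (by norm_num)
    all_goals exact hle h (by norm_num) (by norm_num)
end
end

section
/- For every prime p ≥ 5, ss_p(X)² = (X − 1728)^ε · Σ_{n=0}^{(p−1+8δ)/6} C(2n,n)·C(3n,n)·C(6n,3n)·X^{(p−1+8δ)/6 − n} as polynomials in 𝔽_p[X] (the binomial coefficients being reduced mod p). -/
open Polynomial

noncomputable section

variable (p : ℕ) [Fact p.Prime]

/-- Deuring's supersingular polynomial ss_p(X) ∈ 𝔽_p[X], via its hypergeometric
expression: (X-1728)^ε · Σ_{n=0}^{m} ((-m)_n (β)_n / (n!)²) 1728^n X^{m+δ-n},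
with m = ⌊p/12⌋ and β = 5/12 - (2δ-3ε)/6. -/
def ssPoly : (ZMod p)[X] :=
  (X - C 1728) ^ eps p *
    ∑ n ∈ Finset.range (p / 12 + 1),
      C (poch p (-(p / 12 : ℕ) : ZMod p) n *
         poch p ((5 : ZMod p) / 12 - (((2 * (del p : ℤ) - 3 * (eps p : ℤ)) : ℤ) : ZMod p) / 6) n /
         ((n.factorial : ZMod p)) ^ 2 * 1728 ^ n) *
      X ^ (p / 12 + del p - n)

/-- L(p): the number of distinct roots of ss_p(X) in 𝔽_p. -/
def LL : ℕ := (ssPoly p).roots.toFinset.card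

section SupersingularSquare

/-- The Euler operator `T · d/dT` on polynomials. -/
def eulerOp {R : Type*} [CommRing R] (f : R[X]) : R[X] := X * derivative f

lemma coeff_eulerOp {R : Type*} [CommRing R] (f : R[X]) (n : ℕ) :
    (eulerOp f).coeff n = n * f.coeff n := by
  cases n with
  | zero => simp [eulerOp]
  | succ n => simp [eulerOp, coeff_derivative, mul_comm]

lemma eulerOp_add {R : Type*} [CommRing R] (f g : R[X]) :
    eulerOp (f + g) = eulerOp f + eulerOp g := by
  simp [eulerOp, mul_add]

lemma eulerOp_mul {R : Type*} [CommRing R] (f g : R[X]) :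
    eulerOp (f * g) = eulerOp f * g + f * eulerOp g := by
  simp only [eulerOp, derivative_mul]; ring

lemma eulerOp_C {R : Type*} [CommRing R] (a : R) : eulerOp (C a) = 0 := by
  simp [eulerOp]

lemma eulerOp_X {R : Type*} [CommRing R] : eulerOp (X : R[X]) = X := by
  simp [eulerOp]

/-- Clausen's product formula for the exponents `1/12` and `5/12`, as a differential equation. -/
lemma clausen_one_five {R : Type*} [CommRing R] (k : R) (f : R[X])
    (h : C 144 * eulerOp (eulerOp f) =
      C k * X * (C 144 * eulerOp (eulerOp f) + C 72 * eulerOp f + C 5 * f)) :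
    C 144 * eulerOp (eulerOp (eulerOp (f * f))) =
      C k * X * (C 144 * eulerOp (eulerOp (eulerOp (f * f))) +
        C 216 * eulerOp (eulerOp (f * f)) + C 92 * eulerOp (f * f) + C 10 * (f * f)) := by
  have h' := congrArg eulerOp h
  simp only [eulerOp_mul, eulerOp_add, eulerOp_C, eulerOp_X, zero_mul, zero_add] at h'
  simp only [eulerOp_mul, eulerOp_add]
  simp only [map_ofNat] at h h' ⊢
  linear_combination 6 * eulerOp f * h + 2 * f * h'

/-- Clausen's product formula for the exponents `7/12` and `11/12`, combined with Euler's
transformation, as a differential equation. -/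
lemma clausen_seven_eleven {R : Type*} [CommRing R] (k : R) (f : R[X])
    (h : C 144 * eulerOp (eulerOp f) =
      C k * X * (C 144 * eulerOp (eulerOp f) + C 216 * eulerOp f + C 77 * f)) :
    C 144 * eulerOp (eulerOp (eulerOp (f * f + C (-k) * X * (f * f)))) =
      C k * X * (C 144 * eulerOp (eulerOp (eulerOp (f * f + C (-k) * X * (f * f)))) +
        C 216 * eulerOp (eulerOp (f * f + C (-k) * X * (f * f))) +
        C 92 * eulerOp (f * f + C (-k) * X * (f * f)) +
        C 10 * (f * f + C (-k) * X * (f * f))) := by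
  have h' := congrArg eulerOp h
  simp only [eulerOp_mul, eulerOp_add, eulerOp_C, eulerOp_X, zero_mul, zero_add] at h'
  simp only [eulerOp_mul, eulerOp_add, eulerOp_C, eulerOp_X, zero_mul, zero_add]
  simp only [map_ofNat, map_neg] at h h' ⊢
  linear_combination (1 - C k * X) * (6 * eulerOp f * h + 2 * f * h') - 4 * C k * X * f * h

/-- The coefficients of a polynomial solution of a hypergeometric differential equation. -/
lemma coeff_recurrence_of_eulerOp {R : Type*} [CommRing R] (k : R) (g : R[X])
    (h : C 144 * eulerOp (eulerOp (eulerOp g)) =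
      C k * X * (C 144 * eulerOp (eulerOp (eulerOp g)) +
        C 216 * eulerOp (eulerOp g) + C 92 * eulerOp g + C 10 * g)) (n : ℕ) :
    144 * ((n : R) + 1) ^ 3 * g.coeff (n + 1) =
      k * (2 * (6 * n + 1) * (2 * n + 1) * (6 * n + 5)) * g.coeff n := by
  have h' := congrArg (fun q => q.coeff (n + 1)) h
  simp only [mul_assoc, coeff_C_mul, coeff_X_mul, coeff_add, coeff_eulerOp] at h'
  push_cast at h'
  linear_combination h'

lemma choose_mul_factorials (n : ℕ) :
    (2 * n).choose n * (3 * n).choose n * (6 * n).choose (3 * n) *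
      (n.factorial ^ 3 * (3 * n).factorial) = (6 * n).factorial := by
  have h2 := Nat.choose_mul_factorial_mul_factorial (show n ≤ 2 * n by omega)
  have h3 := Nat.choose_mul_factorial_mul_factorial (show n ≤ 3 * n by omega)
  have h6 := Nat.choose_mul_factorial_mul_factorial (show 3 * n ≤ 6 * n by omega)
  rw [show 2 * n - n = n by omega] at h2
  rw [show 3 * n - n = 2 * n by omega] at h3
  rw [show 6 * n - 3 * n = 3 * n by omega] at h6
  rw [← h6]
  conv_rhs => rw [← h3, ← h2]
  rw [← h3, ← h2]
  ring

lemma choose_mul_recurrence (n : ℕ) :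
    (n + 1) ^ 3 * ((2 * (n + 1)).choose (n + 1) * (3 * (n + 1)).choose (n + 1) *
        (6 * (n + 1)).choose (3 * (n + 1))) =
      24 * (6 * n + 1) * (2 * n + 1) * (6 * n + 5) *
        ((2 * n).choose n * (3 * n).choose n * (6 * n).choose (3 * n)) := by
  have h0 := choose_mul_factorials n
  have h1 := choose_mul_factorials (n + 1)
  generalize (2 * (n + 1)).choose (n + 1) * (3 * (n + 1)).choose (n + 1) *
        (6 * (n + 1)).choose (3 * (n + 1)) = c' at *
  generalize (2 * n).choose n * (3 * n).choose n * (6 * n).choose (3 * n) = c at *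
  rw [show 6 * (n + 1) = 6 * n + 5 + 1 by ring, show 3 * (n + 1) = 3 * n + 2 + 1 by ring] at h1
  simp only [Nat.factorial_succ] at h1
  rw [← h0] at h1
  have hpos : 0 < n.factorial ^ 3 * (3 * n).factorial * ((3 * n + 3) * (3 * n + 2) * (3 * n + 1)) := by
    positivity
  apply Nat.eq_of_mul_eq_mul_right hpos
  linear_combination h1

lemma eq_twelve_mul_add (hp : 5 ≤ p) :
    (p = 12 * (p / 12) + 1 + 4 * del p + 6 * eps p) ∧ del p ≤ 1 ∧ eps p ≤ 1 := by
  have hpp : p.Prime := Fact.out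
  have h2 : p % 2 = 1 := hpp.eq_two_or_odd.resolve_left (by omega)
  have h3 : p % 3 ≠ 0 := fun h => by
    have := (Nat.prime_dvd_prime_iff_eq Nat.prime_three hpp).1 (Nat.dvd_of_mod_eq_zero h)
    omega
  have hε := legendreSym.at_neg_one (p := p) (by omega)
  have hq : legendreSym p 3 = (-1) ^ (3 / 2 * (p / 2)) * legendreSym 3 p :=
    legendreSym.quadratic_reciprocity' (p := 3) (q := p) (by omega) (by omega)
  have hχ := ZMod.χ₄_eq_neg_one_pow h2
  have hδ : legendreSym p (-3) = legendreSym 3 p := by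
    rw [show (-3 : ℤ) = -1 * 3 by norm_num, legendreSym.mul, hε, hq, hχ, ← mul_assoc, ← pow_add,
      Even.neg_one_pow ⟨p / 2, by ring⟩, one_mul]
  rw [legendreSym.mod 3] at hδ
  have e1 : legendreSym 3 1 = 1 := by simp
  have e2 : legendreSym 3 2 = -1 := by decide
  unfold del eps
  rw [hε, hδ]
  have h4 : p % 4 = 1 ∨ p % 4 = 3 := by omega
  have h3' : (p % 3 = 1 ∧ ((p : ℤ) % (3 : ℕ)) = 1) ∨ (p % 3 = 2 ∧ ((p : ℤ) % (3 : ℕ)) = 2) := by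
    omega
  rcases h4 with h4 | h4 <;> rcases h3' with ⟨h3', h3''⟩ | ⟨h3', h3''⟩ <;>
    simp only [h3'', e1, e2, ZMod.χ₄_nat_one_mod_four, ZMod.χ₄_nat_three_mod_four, h4] <;>
    norm_num <;> omega

lemma natCast_ne_zero_of_lt {n : ℕ} (h0 : 0 < n) (hn : n < p) : (n : ZMod p) ≠ 0 := fun h =>
  absurd (Nat.le_of_dvd h0 ((ZMod.natCast_eq_zero_iff n p).1 h)) (by omega)

lemma twelve_ne_zero (hp : 5 ≤ p) : (12 : ZMod p) ≠ 0 := by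
  have h2 : (2 : ZMod p) ≠ 0 := by
    exact_mod_cast natCast_ne_zero_of_lt p (n := 2) (by omega) (by omega)
  have h3 : (3 : ZMod p) ≠ 0 := by
    exact_mod_cast natCast_ne_zero_of_lt p (n := 3) (by omega) (by omega)
  rw [show (12 : ZMod p) = 2 * 2 * 3 by norm_num]
  exact mul_ne_zero (mul_ne_zero h2 h2) h3

/-- The coefficients of `₂F₁(a, b; 1; kT)`. -/
def hypCoeff (a b k : ZMod p) (n : ℕ) : ZMod p :=
  poch p a n * poch p b n / (n.factorial : ZMod p) ^ 2 * k ^ n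

lemma hypCoeff_zero (a b k : ZMod p) : hypCoeff p a b k 0 = 1 := by
  simp [hypCoeff, poch]

lemma hypCoeff_succ (a b k : ZMod p) {n : ℕ} (hn : n + 1 < p) :
    ((n : ZMod p) + 1) ^ 2 * hypCoeff p a b k (n + 1) =
      k * ((n + a) * (n + b)) * hypCoeff p a b k n := by
  have h1 : (n : ZMod p) + 1 ≠ 0 := by
    exact_mod_cast natCast_ne_zero_of_lt p n.succ_pos hn
  have h2 : (n.factorial : ZMod p) ≠ 0 := by
    rw [Ne, ZMod.natCast_eq_zero_iff, (Fact.out : p.Prime).dvd_factorial]; omega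
  simp only [hypCoeff, poch, ascPochhammer_succ_eval, Nat.factorial_succ]
  push_cast
  field_simp
  ring

/-- The polynomial `∑ₙ (-m)ₙ (b)ₙ / n!² (kT)ⁿ`. -/
def hypPoly (m : ℕ) (b k : ZMod p) : (ZMod p)[X] :=
  ∑ n ∈ Finset.range (m + 1), C (hypCoeff p (-(m : ZMod p)) b k n) * X ^ n

lemma coeff_hypPoly (m : ℕ) (b k : ZMod p) (n : ℕ) :
    (hypPoly p m b k).coeff n = if n ≤ m then hypCoeff p (-(m : ZMod p)) b k n else 0 := by
  simp [hypPoly, coeff_C_mul, coeff_X_pow]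

lemma natDegree_hypPoly_le (m : ℕ) (b k : ZMod p) : (hypPoly p m b k).natDegree ≤ m := by
  rw [natDegree_le_iff_coeff_eq_zero]
  intro n hn
  rw [coeff_hypPoly, if_neg (by omega)]

lemma eulerOp_hypPoly {m : ℕ} (hm : m < p) (b k A B : ZMod p)
    (hA : 12 * (-(m : ZMod p)) = A) (hB : 12 * b = B) :
    C 144 * eulerOp (eulerOp (hypPoly p m b k)) =
      C k * X * (C 144 * eulerOp (eulerOp (hypPoly p m b k)) +
        C (12 * (A + B)) * eulerOp (hypPoly p m b k) + C (A * B) * hypPoly p m b k) := by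
  ext n
  cases n with
  | zero => simp [coeff_eulerOp, mul_assoc]
  | succ n =>
    simp only [mul_assoc, coeff_C_mul, coeff_X_mul, coeff_add, coeff_eulerOp, coeff_hypPoly]
    subst hA hB
    push_cast
    rcases lt_trichotomy n m with h | rfl | h
    · rw [if_pos (by omega), if_pos (by omega)]
      linear_combination 144 * hypCoeff_succ p (-(m : ZMod p)) b k (n := n) (by omega)
    · rw [if_neg (by omega), if_pos le_rfl]
      ring
    · rw [if_neg (by omega), if_neg (by omega)]
      ring

lemma coeff_eq_choose_of_eulerOp (hp : 5 ≤ p) (g : (ZMod p)[X])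
    (h : C 144 * eulerOp (eulerOp (eulerOp g)) =
      C 1728 * X * (C 144 * eulerOp (eulerOp (eulerOp g)) +
        C 216 * eulerOp (eulerOp g) + C 92 * eulerOp g + C 10 * g))
    (h0 : g.coeff 0 = 1) {n : ℕ} (hn : n < p) :
    g.coeff n = (((2 * n).choose n : ℕ) : ZMod p) * (((3 * n).choose n : ℕ) : ZMod p) *
      (((6 * n).choose (3 * n) : ℕ) : ZMod p) := by
  induction n with
  | zero => simp [h0]
  | succ n ih =>
    have h1 : (n : ZMod p) + 1 ≠ 0 := by
      exact_mod_cast natCast_ne_zero_of_lt p n.succ_pos hn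
    have h12 := twelve_ne_zero p hp
    have hg := coeff_recurrence_of_eulerOp 1728 g h n
    have hc := congrArg (Nat.cast : ℕ → ZMod p) (choose_mul_recurrence n)
    rw [ih (by omega)] at hg
    push_cast at hc
    apply mul_left_cancel₀ (mul_ne_zero (pow_ne_zero 2 h12) (pow_ne_zero 3 h1))
    linear_combination hg - 144 * hc

lemma hypPoly_sq_eq (hp : 5 ≤ p) :
    (1 + C (-1728) * X) ^ eps p * hypPoly p (p / 12)
        ((5 : ZMod p) / 12 - (((2 * (del p : ℤ) - 3 * (eps p : ℤ)) : ℤ) : ZMod p) / 6) 1728 ^ 2 =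
      ∑ n ∈ Finset.range ((p - 1 + 8 * del p) / 6 + 1),
        C ((((2 * n).choose n : ℕ) : ZMod p) * (((3 * n).choose n : ℕ) : ZMod p) *
          (((6 * n).choose (3 * n) : ℕ) : ZMod p)) * X ^ n := by
  obtain ⟨hmod, hd, he⟩ := eq_twelve_mul_add p hp
  have h12 := twelve_ne_zero p hp
  have h6 : (6 : ZMod p) ≠ 0 := fun h => h12 (by linear_combination 2 * h)
  set b : ZMod p := (5 : ZMod p) / 12 -
    (((2 * (del p : ℤ) - 3 * (eps p : ℤ)) : ℤ) : ZMod p) / 6 with hb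
  have hB : 12 * b = 5 - 4 * (del p : ZMod p) + 6 * (eps p : ZMod p) := by
    rw [hb]; push_cast; field_simp; ring
  have hA : 12 * (-((p / 12 : ℕ) : ZMod p)) = 1 + 4 * (del p : ZMod p) + 6 * (eps p : ZMod p) := by
    have := congrArg (Nat.cast : ℕ → ZMod p) hmod
    rw [ZMod.natCast_self] at this
    push_cast at this ⊢
    linear_combination this
  have hode := eulerOp_hypPoly p (m := p / 12) (by omega) b 1728 _ _ hA hB
  have hF0 : (hypPoly p (p / 12) b 1728).coeff 0 = 1 := by
    rw [coeff_hypPoly, if_pos (Nat.zero_le _), hypCoeff_zero]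
  have hdeg := natDegree_hypPoly_le p (p / 12) b 1728
  generalize hypPoly p (p / 12) b 1728 = F at *
  set G := (1 + C (-1728) * X) ^ eps p * F ^ 2 with hG
  have hGdeg : G.natDegree ≤ (p - 1 + 8 * del p) / 6 := by
    have h1 : (1 + C (-1728) * X : (ZMod p)[X]).natDegree ≤ 1 := by compute_degree
    have h2 := natDegree_mul_le_of_le (natDegree_pow_le_of_le (eps p) h1)
      (natDegree_pow_le_of_le 2 hdeg)
    refine h2.trans ?_
    omega
  have hGode : C 144 * eulerOp (eulerOp (eulerOp G)) =
      C 1728 * X * (C 144 * eulerOp (eulerOp (eulerOp G)) +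
        C 216 * eulerOp (eulerOp G) + C 92 * eulerOp G + C 10 * G) := by
    interval_cases eps p
    · have : G = F * F := by rw [hG]; ring
      rw [this]
      apply clausen_one_five
      convert hode using 5
      · push_cast; ring_nf
      · interval_cases del p <;> norm_num
    · have : G = F * F + C (-1728) * X * (F * F) := by rw [hG]; ring
      rw [this]
      apply clausen_seven_eleven
      convert hode using 5
      · push_cast; ring_nf
      · interval_cases del p <;> norm_num
  have hG0 : G.coeff 0 = 1 := by
    rw [hG, coeff_zero_eq_eval_zero] at *
    simp [hF0]
  ext n
  rw [finsetSum_coeff]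
  simp only [coeff_C_mul, coeff_X_pow, mul_ite, mul_one, mul_zero, Finset.sum_ite_eq,
    Finset.mem_range]
  split_ifs with hn
  · exact coeff_eq_choose_of_eulerOp p hp G hGode hG0 (by omega)
  · exact coeff_eq_zero_of_natDegree_lt (by omega)

lemma reflect_sum_C_mul_X_pow {R : Type*} [CommRing R] (c : ℕ → R) {m N : ℕ} (h : m ≤ N) :
    reflect N (∑ n ∈ Finset.range (m + 1), C (c n) * X ^ n) =
      ∑ n ∈ Finset.range (m + 1), C (c n) * X ^ (N - n) := by
  have hsum (s : Finset ℕ) (f : ℕ → R[X]) :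
      reflect N (∑ n ∈ s, f n) = ∑ n ∈ s, reflect N (f n) :=
    map_sum (⟨⟨reflect N, reflect_zero⟩, fun f g => reflect_add f g N⟩ : R[X] →+ R[X]) f s
  rw [hsum]
  refine Finset.sum_congr rfl fun n hn => ?_
  rw [Finset.mem_range] at hn
  rw [reflect_C_mul_X_pow, revAt_le (by omega)]

end SupersingularSquare

/-- For every prime p ≥ 5, ss_p(X)² = (X − 1728)^ε ·
Σ_{n=0}^{(p−1+8δ)/6} C(2n,n)·C(3n,n)·C(6n,3n)·X^{(p−1+8δ)/6 − n} in 𝔽_p[X]. -/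
theorem ssp_sq_explicit (hp : 5 ≤ p) :
    (ssPoly p) ^ 2 =
      (X - C 1728) ^ eps p *
        ∑ n ∈ Finset.range ((p - 1 + 8 * del p) / 6 + 1),
          C ((((2 * n).choose n : ℕ) : ZMod p) * (((3 * n).choose n : ℕ) : ZMod p) *
              (((6 * n).choose (3 * n) : ℕ) : ZMod p)) *
            X ^ ((p - 1 + 8 * del p) / 6 - n) := by
  obtain ⟨hmod, hd, he⟩ := eq_twelve_mul_add p hp
  have hsq := hypPoly_sq_eq p hp
  have hdeg := natDegree_hypPoly_le p (p / 12)
    ((5 : ZMod p) / 12 - (((2 * (del p : ℤ) - 3 * (eps p : ℤ)) : ℤ) : ZMod p) / 6) 1728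
  rw [← reflect_sum_C_mul_X_pow _ le_rfl, ← hsq, ssPoly,
    ← reflect_sum_C_mul_X_pow _ (Nat.le_add_right (p / 12) (del p))]
  change ((X - C 1728) ^ eps p * reflect (p / 12 + del p) (hypPoly p (p / 12)
    ((5 : ZMod p) / 12 - (((2 * (del p : ℤ) - 3 * (eps p : ℤ)) : ℤ) : ZMod p) / 6) 1728)) ^ 2 = _
  generalize hypPoly p (p / 12) ((5 : ZMod p) / 12 -
    (((2 * (del p : ℤ) - 3 * (eps p : ℤ)) : ℤ) : ZMod p) / 6) 1728 = F at *
  have hF : F.natDegree ≤ p / 12 + del p := by omega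
  have hlin : (1 + C (-1728) * X : (ZMod p)[X]).natDegree ≤ 1 := by compute_degree
  have hrlin : reflect 1 (1 + C (-1728) * X : (ZMod p)[X]) = X - C 1728 := by
    rw [reflect_add, ← pow_one (X : (ZMod p)[X]), reflect_C_mul_X_pow, ← C_1, reflect_C,
      revAt_le le_rfl]
    simp [sub_eq_add_neg]
  have hpow : reflect (eps p) ((1 + C (-1728) * X : (ZMod p)[X]) ^ eps p) =
      (X - C 1728) ^ eps p := by
    interval_cases eps p
    · simp
    · simpa using hrlin
  have hpowdeg : ((1 + C (-1728) * X : (ZMod p)[X]) ^ eps p).natDegree ≤ eps p := by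
    simpa using natDegree_pow_le_of_le (eps p) hlin
  have hFF : (F * F).natDegree ≤ (p / 12 + del p) + (p / 12 + del p) :=
    natDegree_mul_le_of_le hF hF
  rw [show (p - 1 + 8 * del p) / 6 = eps p + ((p / 12 + del p) + (p / 12 + del p)) by omega,
    pow_two F, reflect_mul _ _ hpowdeg hFF, reflect_mul _ _ hF hF, hpow]
  ring
end
end
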